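/- arXiv:1909.10074 — 7 statements merged into one kernel-verified Lean document; each statement's English description precedes it below -/
import Mathlib

section
/- For every block lower triangular matrix K ∈ ℝ^{(T+1)p×(T+1)n}, the matrix Z(Â+B̂K) is strictly block lower triangular and nilpotent, the matrix I − Z(Â+B̂K) is invertible, and the system responses Φx := (I − Z(Â+B̂K))⁻¹ and Φu := K(I − Z(Â+B̂K))⁻¹ are block lower triangular and satisfy the affine constraint (I − ZÂ)Φx − ZB̂Φu = I. -/
open Matrix

/-- `Â = blkdiag(A, …, A, 0)`: block diagonal with `T` copies of `A` followed by a zero block. -/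
noncomputable def Ahat {n : ℕ} (T : ℕ) (A : Matrix (Fin n) (Fin n) ℝ) :
    Matrix (Fin (T + 1) × Fin n) (Fin (T + 1) × Fin n) ℝ :=
  fun si tj => if si.1 = tj.1 ∧ (si.1 : ℕ) < T then A si.2 tj.2 else 0

/-- `B̂ = blkdiag(B, …, B, 0)`: block diagonal with `T` copies of `B` followed by a zero block. -/
noncomputable def Bhat {n p : ℕ} (T : ℕ) (B : Matrix (Fin n) (Fin p) ℝ) :
    Matrix (Fin (T + 1) × Fin n) (Fin (T + 1) × Fin p) ℝ :=
  fun si tj => if si.1 = tj.1 ∧ (si.1 : ℕ) < T then B si.2 tj.2 else 0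

/-- The block-downshift matrix `Z`: identity blocks on the first block subdiagonal. -/
noncomputable def Zshift (T n : ℕ) :
    Matrix (Fin (T + 1) × Fin n) (Fin (T + 1) × Fin n) ℝ :=
  fun si tj => if (si.1 : ℕ) = (tj.1 : ℕ) + 1 ∧ si.2 = tj.2 then 1 else 0

/-- A block matrix (blocks indexed by times `0, …, T`) is block lower triangular if its
`(s, t)` block vanishes whenever `s < t`. -/
def BlockLowerTri {T a b : ℕ} (M : Matrix (Fin (T + 1) × Fin a) (Fin (T + 1) × Fin b) ℝ) :
    Prop :=
  ∀ (s t : Fin (T + 1)) (i : Fin a) (j : Fin b), (s : ℕ) < (t : ℕ) → M (s, i) (t, j) = 0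

/-- A block matrix is strictly block lower triangular if its `(s, t)` block vanishes
whenever `s ≤ t`. -/
def StrictBlockLowerTri {T a b : ℕ}
    (M : Matrix (Fin (T + 1) × Fin a) (Fin (T + 1) × Fin b) ℝ) : Prop :=
  ∀ (s t : Fin (T + 1)) (i : Fin a) (j : Fin b), (s : ℕ) ≤ (t : ℕ) → M (s, i) (t, j) = 0

/-- The `(s, t)` block of a product vanishes for `s < t + (d + e)` when the factors' blocks vanish
for `s < t + d` and `s < t + e` respectively. -/
theorem mul_apply_eq_zero_of_lt_add {T a b c d e : ℕ}
    {M : Matrix (Fin (T + 1) × Fin a) (Fin (T + 1) × Fin b) ℝ}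
    {N : Matrix (Fin (T + 1) × Fin b) (Fin (T + 1) × Fin c) ℝ}
    (hM : ∀ x y, (x.1 : ℕ) < y.1 + d → M x y = 0)
    (hN : ∀ x y, (x.1 : ℕ) < y.1 + e → N x y = 0)
    (x : Fin (T + 1) × Fin a) (y : Fin (T + 1) × Fin c)
    (hxy : (x.1 : ℕ) < y.1 + (d + e)) : (M * N) x y = 0 := by
  rw [Matrix.mul_apply]
  refine Finset.sum_eq_zero fun z _ => ?_
  by_cases h : (x.1 : ℕ) < z.1 + d
  · rw [hM x z h, zero_mul]
  · rw [hN z y (by omega), mul_zero]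

theorem BlockLowerTri.mul {T a b c : ℕ}
    {M : Matrix (Fin (T + 1) × Fin a) (Fin (T + 1) × Fin b) ℝ}
    {N : Matrix (Fin (T + 1) × Fin b) (Fin (T + 1) × Fin c) ℝ}
    (hM : BlockLowerTri M) (hN : BlockLowerTri N) : BlockLowerTri (M * N) := fun s t i j h =>
  mul_apply_eq_zero_of_lt_add (d := 0) (e := 0) (fun x y => hM x.1 y.1 x.2 y.2)
    (fun x y => hN x.1 y.1 x.2 y.2) (s, i) (t, j) h

theorem BlockLowerTri.add {T a b : ℕ}
    {M N : Matrix (Fin (T + 1) × Fin a) (Fin (T + 1) × Fin b) ℝ}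
    (hM : BlockLowerTri M) (hN : BlockLowerTri N) : BlockLowerTri (M + N) := fun s t i j h => by
  rw [Matrix.add_apply, hM s t i j h, hN s t i j h, add_zero]

theorem blockLowerTri_Ahat {n T : ℕ} (A : Matrix (Fin n) (Fin n) ℝ) :
    BlockLowerTri (Ahat T A) := fun _ _ _ _ h =>
  if_neg fun hst => h.ne (congrArg Fin.val hst.1)

theorem blockLowerTri_Bhat {n p T : ℕ} (B : Matrix (Fin n) (Fin p) ℝ) :
    BlockLowerTri (Bhat T B) := fun _ _ _ _ h =>
  if_neg fun hst => h.ne (congrArg Fin.val hst.1)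

theorem strictBlockLowerTri_Zshift (T n : ℕ) : StrictBlockLowerTri (Zshift T n) :=
  fun s t i j h => if_neg fun hst => by
    have := hst.1
    dsimp only at this
    omega

theorem StrictBlockLowerTri.mul_blockLowerTri {T a b c : ℕ}
    {M : Matrix (Fin (T + 1) × Fin a) (Fin (T + 1) × Fin b) ℝ}
    {N : Matrix (Fin (T + 1) × Fin b) (Fin (T + 1) × Fin c) ℝ}
    (hM : StrictBlockLowerTri M) (hN : BlockLowerTri N) : StrictBlockLowerTri (M * N) :=
  fun s t i j h =>
    mul_apply_eq_zero_of_lt_add (d := 1) (e := 0)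
      (fun x y hxy => hM x.1 y.1 x.2 y.2 (Nat.lt_succ_iff.mp hxy))
      (fun x y => hN x.1 y.1 x.2 y.2) (s, i) (t, j) (Nat.lt_succ_iff.mpr h)

theorem StrictBlockLowerTri.isNilpotent {T a : ℕ}
    {M : Matrix (Fin (T + 1) × Fin a) (Fin (T + 1) × Fin a) ℝ}
    (hM : StrictBlockLowerTri M) : IsNilpotent M := by
  have hpow : ∀ (k : ℕ) (x y : Fin (T + 1) × Fin a), (x.1 : ℕ) < y.1 + k → (M ^ k) x y = 0 := by
    intro k
    induction k with
    | zero =>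
      intro x y hxy
      rw [pow_zero]
      exact Matrix.one_apply_ne fun h => by simp [h] at hxy
    | succ k ih =>
      rw [pow_succ]
      exact mul_apply_eq_zero_of_lt_add ih fun x y hxy =>
        hM x.1 y.1 x.2 y.2 (Nat.lt_succ_iff.mp hxy)
  refine ⟨T + 1, Matrix.ext fun x y => hpow _ x y ?_⟩
  have := x.1.isLt
  omega

theorem blockLowerTri_iff_blockTriangular {T a : ℕ}
    {M : Matrix (Fin (T + 1) × Fin a) (Fin (T + 1) × Fin a) ℝ} :
    BlockLowerTri M ↔ M.BlockTriangular fun x => OrderDual.toDual x.1 :=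
  ⟨fun h x y hxy => h x.1 y.1 x.2 y.2 hxy, fun h _ _ _ _ hst => h hst⟩

theorem BlockLowerTri.inv {T a : ℕ}
    {M : Matrix (Fin (T + 1) × Fin a) (Fin (T + 1) × Fin a) ℝ}
    (hM : BlockLowerTri M) (hu : IsUnit M) : BlockLowerTri M⁻¹ := by
  have := hu.invertible
  rw [blockLowerTri_iff_blockTriangular] at hM ⊢
  exact Matrix.blockTriangular_inv_of_blockTriangular hM

theorem StrictBlockLowerTri.blockLowerTri_one_sub {T a : ℕ}
    {M : Matrix (Fin (T + 1) × Fin a) (Fin (T + 1) × Fin a) ℝ}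
    (hM : StrictBlockLowerTri M) : BlockLowerTri (1 - M) := fun s t i j h => by
  rw [Matrix.sub_apply, hM s t i j h.le, sub_zero]
  exact Matrix.one_apply_ne fun hst => h.ne (congrArg (fun x => (x.1 : ℕ)) hst)

/-- for every block lower triangular `K`, the matrix `Z(Â + B̂K)` is strictly
block lower triangular and nilpotent, `I - Z(Â + B̂K)` is invertible, and the system responses
`Φx := (I - Z(Â + B̂K))⁻¹`, `Φu := K (I - Z(Â + B̂K))⁻¹` are block lower triangular and satisfy
`(I - ZÂ) Φx - ZB̂ Φu = I`. -/
theorem sls_achievability {n p T : ℕ}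
    (A : Matrix (Fin n) (Fin n) ℝ) (B : Matrix (Fin n) (Fin p) ℝ)
    (K : Matrix (Fin (T + 1) × Fin p) (Fin (T + 1) × Fin n) ℝ)
    (hK : BlockLowerTri K) :
    StrictBlockLowerTri (Zshift T n * (Ahat T A + Bhat T B * K)) ∧
    IsNilpotent (Zshift T n * (Ahat T A + Bhat T B * K)) ∧
    IsUnit (1 - Zshift T n * (Ahat T A + Bhat T B * K)) ∧
    BlockLowerTri (1 - Zshift T n * (Ahat T A + Bhat T B * K))⁻¹ ∧
    BlockLowerTri (K * (1 - Zshift T n * (Ahat T A + Bhat T B * K))⁻¹) ∧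
    (1 - Zshift T n * Ahat T A) * (1 - Zshift T n * (Ahat T A + Bhat T B * K))⁻¹ -
      Zshift T n * Bhat T B * (K * (1 - Zshift T n * (Ahat T A + Bhat T B * K))⁻¹) = 1 := by
  have hS : StrictBlockLowerTri (Zshift T n * (Ahat T A + Bhat T B * K)) :=
    (strictBlockLowerTri_Zshift T n).mul_blockLowerTri
      ((blockLowerTri_Ahat A).add ((blockLowerTri_Bhat B).mul hK))
  have hu : IsUnit (1 - Zshift T n * (Ahat T A + Bhat T B * K)) := hS.isNilpotent.isUnit_one_sub
  have hinv := hS.blockLowerTri_one_sub.inv hu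
  refine ⟨hS, hS.isNilpotent, hu, hinv, hK.mul hinv, ?_⟩
  have hfactor : 1 - Zshift T n * Ahat T A - Zshift T n * Bhat T B * K =
      1 - Zshift T n * (Ahat T A + Bhat T B * K) := by
    rw [Matrix.mul_add, Matrix.mul_assoc, sub_sub]
  rw [← Matrix.mul_assoc (Zshift T n * Bhat T B), ← Matrix.sub_mul, hfactor]
  exact Matrix.mul_nonsing_inv _ ((Matrix.isUnit_iff_isUnit_det _).mp hu)
end

section
/- Correctness of the SLS controller implementation: let Φx ∈ ℝ^{(T+1)n×(T+1)n} and Φu ∈ ℝ^{(T+1)p×(T+1)n} satisfy (I − ZÂ)Φx − ZB̂Φu = I, and suppose the vectors x, w, ŵ ∈ ℝ^{(T+1)n} and u ∈ ℝ^{(T+1)p} satisfy the plant dynamics x = ZÂx + ZB̂u + w together with the controller implementation equations u = Φu ŵ and ŵ = x − (Φx − I)ŵ. Then ŵ = w, x = Φx w, and u = Φu w; i.e., the implementation achieves the desired closed-loop system responses. -/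
open Matrix

/-- correctness of the SLS controller implementation. If `Φx`, `Φu` satisfy
`(I - ZÂ) Φx - ZB̂ Φu = I`, and signals satisfy the plant dynamics `x = ZÂx + ZB̂u + w`
together with the controller implementation `u = Φu ŵ`, `ŵ = x - (Φx - I) ŵ`, then `ŵ = w`,
`x = Φx w`, and `u = Φu w`. -/
theorem sls_implementation_correct {n p T : ℕ}
    (A : Matrix (Fin n) (Fin n) ℝ) (B : Matrix (Fin n) (Fin p) ℝ)
    (Phix : Matrix (Fin (T + 1) × Fin n) (Fin (T + 1) × Fin n) ℝ)
    (Phiu : Matrix (Fin (T + 1) × Fin p) (Fin (T + 1) × Fin n) ℝ)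
    (hach : (1 - Zshift T n * Ahat T A) * Phix - Zshift T n * Bhat T B * Phiu = 1)
    (x w what : Fin (T + 1) × Fin n → ℝ) (u : Fin (T + 1) × Fin p → ℝ)
    (hplant : x = (Zshift T n * Ahat T A).mulVec x + (Zshift T n * Bhat T B).mulVec u + w)
    (hu : u = Phiu.mulVec what)
    (hwhat : what = x - (Phix - 1).mulVec what) :
    what = w ∧ x = Phix.mulVec w ∧ u = Phiu.mulVec w := by
  have hx : x = Phix.mulVec what := by
    rw [Matrix.sub_mulVec, Matrix.one_mulVec] at hwhat
    ext i
    have := congrFun hwhat i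
    simp only [Pi.sub_apply] at this
    linarith
  have hw : what = w := by
    have h := congrArg (fun M => M.mulVec what) hach
    simp only [Matrix.sub_mulVec, ← Matrix.mulVec_mulVec, Matrix.one_mulVec, ← hx, ← hu] at h
    simp only [← Matrix.mulVec_mulVec] at hplant
    ext i
    have h₁ := congrFun h i
    have h₂ := congrFun hplant i
    simp only [Pi.sub_apply, Pi.add_apply] at h₁ h₂
    linarith
  subst hw
  exact ⟨rfl, hx, hu⟩
end

section
/- Expressivity of the SLS parameterization for a fixed nonzero initial condition: let x0 ∈ ℝⁿ with x0 ≠ 0, let u ∈ ℝ^{(T+1)p} be an arbitrary input signal, and let x ∈ ℝ^{(T+1)n} be the resulting state trajectory, i.e., x is the unique solution of x = ZÂx + ZB̂u + E1x0 (equivalently, x has first block x0 and x_{t+1} = Ax_t + Bu_t for t = 0,…,T−1). Then there exist matrices Φx ∈ ℝ^{(T+1)n×n} and Φu ∈ ℝ^{(T+1)p×n} satisfying the achievability constraint (I − ZÂ)Φx − ZB̂Φu = E1 together with Φx x0 = x and Φu x0 = u. -/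
open Matrix

/-- `E1`: block-column matrix whose first `n × n` block is the identity, remaining blocks 0. -/
noncomputable def E1mat (T n : ℕ) : Matrix (Fin (T + 1) × Fin n) (Fin n) ℝ :=
  fun ti j => if (ti.1 : ℕ) = 0 ∧ ti.2 = j then 1 else 0

/-- The one-step propagation matrix `ZÂ` is strictly block lower triangular. -/
theorem strictBlockLowerTri_Zshift_mul_Ahat {n : ℕ} (T : ℕ) (A : Matrix (Fin n) (Fin n) ℝ) :
    StrictBlockLowerTri (Zshift T n * Ahat T A) := by
  intro s t i j hst
  rw [Matrix.mul_apply]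
  refine Finset.sum_eq_zero fun k _ => ?_
  by_cases hk : k.1 = t
  · have hs : ¬ ((s : ℕ) = (k.1 : ℕ) + 1 ∧ i = k.2) := by
      rw [hk]
      omega
    simp [Zshift, hs]
  · simp [Ahat, hk]

/-- If `N` is strictly block lower triangular, then `1 - N` is invertible. -/
theorem StrictBlockLowerTri.isUnit_one_sub {T n : ℕ}
    {N : Matrix (Fin (T + 1) × Fin n) (Fin (T + 1) × Fin n) ℝ} (hN : StrictBlockLowerTri N) :
    IsUnit (1 - N) := by
  rw [← Matrix.mulVec_injective_iff_isUnit, ← Matrix.coe_mulVecLin, ← LinearMap.ker_eq_bot,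
    LinearMap.ker_eq_bot']
  intro y hy
  rw [Matrix.mulVecLin_apply, Matrix.sub_mulVec, Matrix.one_mulVec, sub_eq_zero] at hy
  have vanish : ∀ (m : ℕ) (s : Fin (T + 1)), (s : ℕ) = m → ∀ i, y (s, i) = 0 := by
    intro m
    induction m using Nat.strong_induction_on with
    | _ m ih =>
      rintro s rfl i
      rw [hy]
      refine Finset.sum_eq_zero fun k _ => ?_
      rcases lt_or_ge (k.1 : ℕ) (s : ℕ) with h | h
      · rw [ih _ h k.1 rfl k.2, mul_zero]
      · exact mul_eq_zero_of_left (hN s k.1 i k.2 h) _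
  exact funext fun k => vanish _ k.1 rfl k.2

/-- expressivity of the SLS parameterization for a fixed nonzero initial
condition. For `x0 ≠ 0`, any input signal `u`, and the resulting state trajectory `x`
(the solution of `x = ZÂx + ZB̂u + E1 x0`), there exist `Φx`, `Φu` with
`(I - ZÂ) Φx - ZB̂ Φu = E1`, `Φx x0 = x` and `Φu x0 = u`. -/
theorem sls_expressivity {n p T : ℕ}
    (A : Matrix (Fin n) (Fin n) ℝ) (B : Matrix (Fin n) (Fin p) ℝ)
    (x0 : Fin n → ℝ) (hx0 : x0 ≠ 0)
    (u : Fin (T + 1) × Fin p → ℝ) (x : Fin (T + 1) × Fin n → ℝ)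
    (hx : x = (Zshift T n * Ahat T A).mulVec x + (Zshift T n * Bhat T B).mulVec u +
      (E1mat T n).mulVec x0) :
    ∃ (Phix : Matrix (Fin (T + 1) × Fin n) (Fin n) ℝ)
      (Phiu : Matrix (Fin (T + 1) × Fin p) (Fin n) ℝ),
      (1 - Zshift T n * Ahat T A) * Phix - Zshift T n * Bhat T B * Phiu = E1mat T n ∧
      Phix.mulVec x0 = x ∧ Phiu.mulVec x0 = u := by
  have hM : IsUnit (1 - Zshift T n * Ahat T A) :=
    (strictBlockLowerTri_Zshift_mul_Ahat T A).isUnit_one_sub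
  have hdet := (Matrix.isUnit_iff_isUnit_det _).mp hM
  have hne : x0 ⬝ᵥ x0 ≠ 0 := fun h => hx0 (dotProduct_self_eq_zero.mp h)
  have hu : (Matrix.vecMulVec u ((x0 ⬝ᵥ x0)⁻¹ • x0)).mulVec x0 = u := by
    rw [Matrix.vecMulVec_mulVec, smul_dotProduct, smul_eq_mul, inv_mul_cancel₀ hne]
    simp
  refine ⟨(1 - Zshift T n * Ahat T A)⁻¹ *
      (E1mat T n + Zshift T n * Bhat T B * Matrix.vecMulVec u ((x0 ⬝ᵥ x0)⁻¹ • x0)),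
    Matrix.vecMulVec u ((x0 ⬝ᵥ x0)⁻¹ • x0), ?_, ?_, hu⟩
  · rw [Matrix.mul_nonsing_inv_cancel_left _ _ hdet, add_sub_cancel_right]
  · apply Matrix.mulVec_injective_iff_isUnit.mpr hM
    rw [Matrix.mulVec_mulVec, Matrix.mul_nonsing_inv_cancel_left _ _ hdet, Matrix.add_mulVec,
      ← Matrix.mulVec_mulVec, hu, Matrix.sub_mulVec, Matrix.one_mulVec, eq_sub_iff_add_eq]
    conv_rhs => rw [hx]
    abel
end

section
/- ADMM residual convergence: under the stated assumptions, the scaled-form ADMM iterates approach feasibility, i.e., the primal residual Ax^k + By^k − c converges to 0 ∈ ℝᵐ as k → ∞. -/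
open Matrix Filter

/-- Squared Euclidean norm of a finite-dimensional real vector. -/
noncomputable def sqnorm {m : ℕ} (v : Fin m → ℝ) : ℝ := ∑ i, (v i) ^ 2

theorem sqnorm_eq_dotProduct {m : ℕ} (v : Fin m → ℝ) : sqnorm v = v ⬝ᵥ v := by
  simp [sqnorm, dotProduct, sq]

theorem sqnorm_nonneg {m : ℕ} (v : Fin m → ℝ) : 0 ≤ sqnorm v :=
  Finset.sum_nonneg fun _ _ => sq_nonneg _

theorem sqnorm_add_smul {m : ℕ} (w v : Fin m → ℝ) (t : ℝ) :
    sqnorm (w + t • v) = sqnorm w + 2 * t * (w ⬝ᵥ v) + t ^ 2 * sqnorm v := by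
  simp only [sqnorm_eq_dotProduct, add_dotProduct, dotProduct_add, smul_dotProduct,
    dotProduct_smul, smul_eq_mul, dotProduct_comm v w]
  ring

theorem two_mul_dotProduct_sub_self {m : ℕ} (u v : Fin m → ℝ) :
    2 * ((u - v) ⬝ᵥ u) = sqnorm u - sqnorm v + sqnorm (u - v) := by
  simp only [sqnorm_eq_dotProduct, sub_dotProduct, dotProduct_sub, dotProduct_comm v u]
  ring

theorem tendsto_zero_of_tendsto_sqnorm {m : ℕ} {r : ℕ → Fin m → ℝ}
    (h : Tendsto (fun k => sqnorm (r k)) atTop (nhds 0)) : Tendsto r atTop (nhds 0) := by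
  refine tendsto_pi_nhds.2 fun i => ?_
  have hsq : Tendsto (fun k => r k i ^ 2) atTop (nhds 0) :=
    squeeze_zero (fun k => sq_nonneg _)
      (fun k => Finset.single_le_sum (f := fun j => r k j ^ 2)
        (fun j _ => sq_nonneg _) (Finset.mem_univ i)) h
  have hsqrt := hsq.sqrt
  simp only [Real.sqrt_sq_eq_abs, Real.sqrt_zero] at hsqrt
  exact (tendsto_zero_iff_abs_tendsto_zero _).2 hsqrt

theorem nonneg_of_forall_add_mul_nonneg {a b : ℝ}
    (h : ∀ t : ℝ, 0 < t → t ≤ 1 → 0 ≤ a + t * b) : 0 ≤ a := by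
  have hlim : Tendsto (fun t : ℝ => a + t * b) (nhdsWithin 0 (Set.Ioi 0)) (nhds a) := by
    have hc : Continuous fun t : ℝ => a + t * b := by fun_prop
    simpa using (hc.tendsto 0).mono_left (nhdsWithin_le_nhds (s := Set.Ioi 0))
  refine ge_of_tendsto hlim ?_
  filter_upwards [Ioc_mem_nhdsGT (zero_lt_one' ℝ)] with t ht using h t ht.1 ht.2

/-- First-order optimality condition for a convex function plus a quadratic penalty. -/
theorem le_add_dotProduct_of_isMin_penalty {n m : ℕ} {φ : (Fin n → ℝ) → ℝ}
    (hφ : ConvexOn ℝ Set.univ φ) {S : Set (Fin n → ℝ)} (hS : Convex ℝ S)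
    (T : Matrix (Fin m) (Fin n) ℝ) (d : Fin m → ℝ) {ρ : ℝ} {p : Fin n → ℝ} (hp : p ∈ S)
    (hmin : ∀ x ∈ S, φ p + ρ / 2 * sqnorm (T *ᵥ p + d) ≤ φ x + ρ / 2 * sqnorm (T *ᵥ x + d))
    {x : Fin n → ℝ} (hx : x ∈ S) :
    φ p ≤ φ x + ρ * ((T *ᵥ p + d) ⬝ᵥ (T *ᵥ x - T *ᵥ p)) := by
  suffices 0 ≤ φ x - φ p + ρ * ((T *ᵥ p + d) ⬝ᵥ (T *ᵥ x - T *ᵥ p)) by linarith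
  refine nonneg_of_forall_add_mul_nonneg (b := ρ / 2 * sqnorm (T *ᵥ x - T *ᵥ p))
    fun t ht ht1 => ?_
  have hmem : (1 - t) • p + t • x ∈ S := hS hp hx (by linarith) ht.le (by ring)
  have hconv : φ ((1 - t) • p + t • x) ≤ (1 - t) * φ p + t * φ x :=
    hφ.2 (Set.mem_univ p) (Set.mem_univ x) (by linarith) ht.le (by ring)
  have hle := hmin _ hmem
  have hT : T *ᵥ ((1 - t) • p + t • x) + d = (T *ᵥ p + d) + t • (T *ᵥ x - T *ᵥ p) := by
    rw [mulVec_add, mulVec_smul, mulVec_smul]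
    module
  rw [hT, sqnorm_add_smul] at hle
  refine nonneg_of_mul_nonneg_right ?_ ht
  linarith

theorem tendsto_zero_of_add_le {V e : ℕ → ℝ} (hV : ∀ k, 0 ≤ V k) (he : ∀ k, 0 ≤ e k)
    (h : ∀ k, V (k + 1) + e k ≤ V k) : Tendsto e atTop (nhds 0) := by
  have hanti : Antitone V := antitone_nat_of_succ_le fun k => by linarith [h k, he k]
  have hlim := tendsto_atTop_ciInf hanti ⟨0, by rintro _ ⟨k, rfl⟩; exact hV k⟩
  have hdiff := hlim.sub (hlim.comp (tendsto_add_atTop_nat 1))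
  rw [sub_self] at hdiff
  exact squeeze_zero he (fun k => by simpa using by linarith [h k]) hdiff

/-- A point maximizing an affine functional over all multipliers is feasible. -/
theorem eq_zero_of_forall_dotProduct_le {m : ℕ} {v w : Fin m → ℝ}
    (h : ∀ u : Fin m → ℝ, u ⬝ᵥ v ≤ w ⬝ᵥ v) : v = 0 := by
  have hv := h (w + v)
  rw [add_dotProduct] at hv
  exact dotProduct_self_eq_zero.1
    (le_antisymm (by linarith) (by simpa [sqnorm_eq_dotProduct] using sqnorm_nonneg v))

/-- The ADMM Lyapunov function decreases by at least the squared primal residual. -/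
theorem admm_lyapunov_decrease {m : ℕ} {ρ : ℝ} (hρ : 0 < ρ) {z z' ls a b b' : Fin m → ℝ}
    (hz : z' = z + a + b')
    (hgap : 0 ≤ ls ⬝ᵥ (a + b') - ρ * ((z' - b' + b) ⬝ᵥ a) - ρ * (z' ⬝ᵥ b'))
    (hmono : 0 ≤ ρ * ((z - z') ⬝ᵥ (b' - b))) :
    sqnorm (z' - ρ⁻¹ • ls) + sqnorm b' + sqnorm (a + b') ≤
      sqnorm (z - ρ⁻¹ • ls) + sqnorm b := by
  have hu := two_mul_dotProduct_sub_self (z' - ρ⁻¹ • ls) (z - ρ⁻¹ • ls)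
  have hb := two_mul_dotProduct_sub_self b' b
  have hdiff : (z' - ρ⁻¹ • ls) - (z - ρ⁻¹ • ls) = a + b' := by rw [hz]; abel
  rw [hdiff] at hu
  have hzz : z - z' = -(a + b') := by rw [hz]; abel
  rw [hzz, neg_dotProduct] at hmono
  have hnn := sqnorm_nonneg (b' - b)
  have hmono' : (a + b') ⬝ᵥ (b' - b) ≤ 0 := by
    have := nonneg_of_mul_nonneg_right hmono hρ
    linarith
  have hls : ls ⬝ᵥ (a + b') = ρ * ((ρ⁻¹ • ls) ⬝ᵥ (a + b')) := by
    rw [smul_dotProduct, smul_eq_mul, mul_inv_cancel_left₀ hρ.ne']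
  have hgap' : 0 ≤ (ρ⁻¹ • ls) ⬝ᵥ (a + b') - (z' - b' + b) ⬝ᵥ a - z' ⬝ᵥ b' := by
    refine nonneg_of_mul_nonneg_right (a := ρ) ?_ hρ
    rw [hls] at hgap
    linarith
  have hcross : (a + b') ⬝ᵥ (z' - ρ⁻¹ • ls) + (b' - b) ⬝ᵥ b' =
      (a + b') ⬝ᵥ (b' - b) -
        ((ρ⁻¹ • ls) ⬝ᵥ (a + b') - (z' - b' + b) ⬝ᵥ a - z' ⬝ᵥ b') := by
    generalize ρ⁻¹ • ls = l
    simp only [add_dotProduct, sub_dotProduct, dotProduct_sub,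
      dotProduct_comm z', dotProduct_comm l, dotProduct_comm b' a, dotProduct_comm b a,
      dotProduct_comm b b']
    ring
  linarith

/-- ADMM residual convergence. Under the stated assumptions (convex
objectives, nonempty closed convex constraint sets, a saddle point of the unaugmented
Lagrangian), the primal residual `A x^k + B y^k - c` of the scaled-form ADMM iterates
converges to `0`. -/
theorem admm_residual_convergence
    {n q m : ℕ}
    (f : (Fin n → ℝ) → ℝ) (g : (Fin q → ℝ) → ℝ)
    (hf : ConvexOn ℝ Set.univ f) (hg : ConvexOn ℝ Set.univ g)
    (X : Set (Fin n → ℝ)) (Y : Set (Fin q → ℝ))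
    (hXne : X.Nonempty) (hXcl : IsClosed X) (hXcv : Convex ℝ X)
    (hYne : Y.Nonempty) (hYcl : IsClosed Y) (hYcv : Convex ℝ Y)
    (A : Matrix (Fin m) (Fin n) ℝ) (B : Matrix (Fin m) (Fin q) ℝ)
    (c : Fin m → ℝ) (ρ : ℝ) (hρ : 0 < ρ)
    -- the (unaugmented) Lagrangian
    (L : (Fin n → ℝ) → (Fin q → ℝ) → (Fin m → ℝ) → ℝ)
    (hL : ∀ x' y' lam, L x' y' lam =
      f x' + g y' + ∑ i, lam i * (A.mulVec x' + B.mulVec y' - c) i)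
    -- saddle point of the Lagrangian
    (xs : Fin n → ℝ) (ys : Fin q → ℝ) (ls : Fin m → ℝ)
    (hxs : xs ∈ X) (hys : ys ∈ Y)
    (hsaddle₁ : ∀ lam : Fin m → ℝ, L xs ys lam ≤ L xs ys ls)
    (hsaddle₂ : ∀ x' ∈ X, ∀ y' ∈ Y, L xs ys ls ≤ L x' y' ls)
    -- scaled-form ADMM iterates
    (x : ℕ → Fin n → ℝ) (y : ℕ → Fin q → ℝ) (z : ℕ → Fin m → ℝ)
    (hxX : ∀ k, x k ∈ X) (hyY : ∀ k, y k ∈ Y)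
    (hxmin : ∀ k, ∀ x' ∈ X,
      f (x (k + 1)) + ρ / 2 * sqnorm (A.mulVec (x (k + 1)) + B.mulVec (y k) - c + z k) ≤
        f x' + ρ / 2 * sqnorm (A.mulVec x' + B.mulVec (y k) - c + z k))
    (hymin : ∀ k, ∀ y' ∈ Y,
      g (y (k + 1)) + ρ / 2 * sqnorm (A.mulVec (x (k + 1)) + B.mulVec (y (k + 1)) - c + z k) ≤
        g y' + ρ / 2 * sqnorm (A.mulVec (x (k + 1)) + B.mulVec y' - c + z k))
    (hzupd : ∀ k, z (k + 1) = z k + A.mulVec (x (k + 1)) + B.mulVec (y (k + 1)) - c)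
    :
    Tendsto (fun k => A.mulVec (x k) + B.mulVec (y k) - c) atTop (nhds 0) := by
  have hfeas : A *ᵥ xs + B *ᵥ ys - c = 0 := by
    refine eq_zero_of_forall_dotProduct_le (w := ls) fun u => ?_
    have h := hsaddle₁ u
    rw [hL, hL] at h
    exact le_of_add_le_add_left h
  have hc : c = A *ᵥ xs + B *ᵥ ys := (sub_eq_zero.1 hfeas).symm
  have hres : ∀ k, A *ᵥ x k + B *ᵥ y k - c =
      (A *ᵥ x k - A *ᵥ xs) + (B *ᵥ y k - B *ᵥ ys) := fun k => by rw [hc]; abel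
  have hxopt : ∀ k, f (x (k + 1)) ≤ f xs +
      ρ * ((z (k + 1) - B *ᵥ y (k + 1) + B *ᵥ y k) ⬝ᵥ (A *ᵥ xs - A *ᵥ x (k + 1))) := by
    intro k
    have h := le_add_dotProduct_of_isMin_penalty hf hXcv A (B *ᵥ y k - c + z k) (hxX (k + 1))
      (fun x' hx' => by
        have := hxmin k x' hx'
        simpa only [add_assoc, add_sub_assoc] using this) hxs
    convert h using 4
    rw [hzupd]
    abel
  have hyopt : ∀ k, ∀ y' ∈ Y, g (y (k + 1)) ≤ g y' +
      ρ * (z (k + 1) ⬝ᵥ (B *ᵥ y' - B *ᵥ y (k + 1))) := by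
    intro k y' hy'
    have hshift : ∀ v, B *ᵥ v + (A *ᵥ x (k + 1) - c + z k) =
        A *ᵥ x (k + 1) + B *ᵥ v - c + z k := fun v => by abel
    have h := le_add_dotProduct_of_isMin_penalty hg hYcv B (A *ᵥ x (k + 1) - c + z k)
      (hyY (k + 1)) (fun v hv => by
        rw [hshift, hshift]
        exact hymin k v hv) hy'
    convert h using 4
    rw [hzupd]
    abel
  have hdecr : ∀ k, sqnorm (z (k + 2) - ρ⁻¹ • ls) + sqnorm (B *ᵥ y (k + 2) - B *ᵥ ys) +
      sqnorm (A *ᵥ x (k + 2) + B *ᵥ y (k + 2) - c) ≤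
      sqnorm (z (k + 1) - ρ⁻¹ • ls) + sqnorm (B *ᵥ y (k + 1) - B *ᵥ ys) := by
    intro k
    rw [hres]
    refine admm_lyapunov_decrease hρ ?_ ?_ ?_
    · rw [hzupd (k + 1), hc]
      abel
    · have hs := hsaddle₂ _ (hxX (k + 2)) _ (hyY (k + 2))
      have hx := hxopt (k + 1)
      have hy := hyopt (k + 1) ys hys
      rw [hL, hL, hfeas, hres] at hs
      change f xs + g ys + ls ⬝ᵥ 0 ≤ f (x (k + 2)) + g (y (k + 2)) +
        ls ⬝ᵥ ((A *ᵥ x (k + 2) - A *ᵥ xs) + (B *ᵥ y (k + 2) - B *ᵥ ys)) at hs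
      rw [dotProduct_zero] at hs
      rw [← neg_sub (A *ᵥ x (k + 1 + 1)), dotProduct_neg] at hx
      rw [← neg_sub (B *ᵥ y (k + 1 + 1)), dotProduct_neg] at hy
      have hb : z (k + 2) - (B *ᵥ y (k + 2) - B *ᵥ ys) + (B *ᵥ y (k + 1) - B *ᵥ ys) =
          z (k + 2) - B *ᵥ y (k + 2) + B *ᵥ y (k + 1) := by abel
      rw [hb]
      linarith
    · have h₁ := hyopt (k + 1) _ (hyY (k + 1))
      have h₂ := hyopt k _ (hyY (k + 2))
      rw [← neg_sub (B *ᵥ y (k + 1 + 1)), dotProduct_neg] at h₁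
      rw [sub_sub_sub_cancel_right, sub_dotProduct]
      linarith
  have hlim := tendsto_zero_of_add_le
    (V := fun k => sqnorm (z (k + 1) - ρ⁻¹ • ls) + sqnorm (B *ᵥ y (k + 1) - B *ᵥ ys))
    (fun k => add_nonneg (sqnorm_nonneg _) (sqnorm_nonneg _)) (fun k => sqnorm_nonneg _) hdecr
  exact (tendsto_add_atTop_iff_nat 2).1 (tendsto_zero_of_tendsto_sqnorm hlim)
end

section
/- ADMM objective convergence: under the stated assumptions, the objective values of the iterates approach the optimal value, i.e., f(x^k) + g(y^k) → p* as k → ∞, where p* := f(x*) + g(y*); moreover p* equals the infimum of f(x) + g(y) over all x ∈ X, y ∈ Y satisfying Ax + By = c. -/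
open Matrix Filter

theorem sqnorm_add {m : ℕ} (a b : Fin m → ℝ) :
    sqnorm (a + b) = sqnorm a + 2 * (a ⬝ᵥ b) + sqnorm b := by
  simp only [sqnorm_eq_dotProduct, add_dotProduct, dotProduct_add, dotProduct_comm b a]
  ring

theorem sqnorm_smul {m : ℕ} (t : ℝ) (a : Fin m → ℝ) : sqnorm (t • a) = t ^ 2 * sqnorm a := by
  simp only [sqnorm_eq_dotProduct, smul_dotProduct, dotProduct_smul, smul_eq_mul]
  ring

theorem sq_dotProduct_le {m : ℕ} (a b : Fin m → ℝ) : (a ⬝ᵥ b) ^ 2 ≤ sqnorm a * sqnorm b :=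
  Finset.sum_mul_sq_le_sq_mul_sq _ _ _

/-- The inner product of a bounded sequence with a null sequence tends to zero. -/
theorem tendsto_dotProduct_zero {m : ℕ} {a b : ℕ → Fin m → ℝ} {C : ℝ}
    (ha : ∀ k, sqnorm (a k) ≤ C) (hb : Tendsto (fun k => sqnorm (b k)) atTop (nhds 0)) :
    Tendsto (fun k => a k ⬝ᵥ b k) atTop (nhds 0) := by
  have hsq : Tendsto (fun k => (a k ⬝ᵥ b k) ^ 2) atTop (nhds 0) :=
    squeeze_zero (fun k => sq_nonneg _)
      (fun k => (sq_dotProduct_le _ _).trans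
        (mul_le_mul_of_nonneg_right (ha k) (sqnorm_nonneg _)))
      (by simpa using hb.const_mul C)
  have habs := hsq.sqrt
  simp only [Real.sqrt_sq_eq_abs, Real.sqrt_zero] at habs
  exact (tendsto_zero_iff_abs_tendsto_zero _).2 habs

/-- If `V` is nonnegative and decreases by at least `s` at each step, then `s` tends to zero. -/
theorem tendsto_zero_of_le_sub {V s : ℕ → ℝ} (hV : ∀ k, 0 ≤ V k) (hs : ∀ k, 0 ≤ s k)
    (h : ∀ k, V (k + 1) ≤ V k - s k) : Tendsto s atTop (nhds 0) := by
  have hanti : Antitone V := antitone_nat_of_succ_le fun k => by linarith [h k, hs k]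
  have hlim := tendsto_atTop_ciInf hanti ⟨0, by rintro _ ⟨k, rfl⟩; exact hV k⟩
  refine squeeze_zero hs (fun k => show s k ≤ V k - V (k + 1) by linarith [h k]) ?_
  simpa using hlim.sub (hlim.comp (tendsto_add_atTop_nat 1))

/-- First-order optimality condition for a convex function plus a quadratic penalty. -/
theorem le_add_dotProduct_of_penalized_min {n m : ℕ} {f : (Fin n → ℝ) → ℝ}
    (hf : ConvexOn ℝ Set.univ f) {X : Set (Fin n → ℝ)} (hX : Convex ℝ X)
    (A : Matrix (Fin m) (Fin n) ℝ) {ρ : ℝ} {x₀ x : Fin n → ℝ} (hx₀ : x₀ ∈ X) (hx : x ∈ X)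
    (w : Fin m → ℝ)
    (hmin : ∀ x' ∈ X, f x₀ + ρ / 2 * sqnorm (A.mulVec x₀ + w) ≤
      f x' + ρ / 2 * sqnorm (A.mulVec x' + w)) :
    f x₀ ≤ f x + ρ * ((A.mulVec x₀ + w) ⬝ᵥ (A.mulVec x - A.mulVec x₀)) := by
  set v := A.mulVec x₀ + w with hv
  set d := A.mulVec x - A.mulVec x₀ with hd
  suffices 0 ≤ f x - f x₀ + ρ * (v ⬝ᵥ d) by linarith
  refine nonneg_of_forall_add_mul_nonneg (b := ρ / 2 * sqnorm d) fun t ht ht1 => ?_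
  have hmem : (1 - t) • x₀ + t • x ∈ X :=
    hX hx₀ hx (by linarith) ht.le (by ring)
  have hconv : f ((1 - t) • x₀ + t • x) ≤ (1 - t) * f x₀ + t * f x :=
    hf.2 (Set.mem_univ _) (Set.mem_univ _) (by linarith) ht.le (by ring)
  have haff : A.mulVec ((1 - t) • x₀ + t • x) + w = v + t • d := by
    rw [mulVec_add, mulVec_smul, mulVec_smul, hv, hd]
    module
  have hle := hmin _ hmem
  rw [haff, sqnorm_add v, sqnorm_smul, dotProduct_smul, smul_eq_mul] at hle
  refine nonneg_of_mul_nonneg_right ?_ ht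
  linarith

/-- ADMM objective convergence. Under the stated assumptions, the objective
values of the iterates approach the optimal value `p* := f(x*) + g(y*)`, which equals the
infimum of `f(x) + g(y)` over feasible `x ∈ X`, `y ∈ Y` with `Ax + By = c`. -/
theorem admm_objective_convergence
    {n q m : ℕ}
    (f : (Fin n → ℝ) → ℝ) (g : (Fin q → ℝ) → ℝ)
    (hf : ConvexOn ℝ Set.univ f) (hg : ConvexOn ℝ Set.univ g)
    (X : Set (Fin n → ℝ)) (Y : Set (Fin q → ℝ))
    (hXne : X.Nonempty) (hXcl : IsClosed X) (hXcv : Convex ℝ X)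
    (hYne : Y.Nonempty) (hYcl : IsClosed Y) (hYcv : Convex ℝ Y)
    (A : Matrix (Fin m) (Fin n) ℝ) (B : Matrix (Fin m) (Fin q) ℝ)
    (c : Fin m → ℝ) (ρ : ℝ) (hρ : 0 < ρ)
    -- the (unaugmented) Lagrangian
    (L : (Fin n → ℝ) → (Fin q → ℝ) → (Fin m → ℝ) → ℝ)
    (hL : ∀ x' y' lam, L x' y' lam =
      f x' + g y' + ∑ i, lam i * (A.mulVec x' + B.mulVec y' - c) i)
    -- saddle point of the Lagrangian
    (xs : Fin n → ℝ) (ys : Fin q → ℝ) (ls : Fin m → ℝ)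
    (hxs : xs ∈ X) (hys : ys ∈ Y)
    (hsaddle₁ : ∀ lam : Fin m → ℝ, L xs ys lam ≤ L xs ys ls)
    (hsaddle₂ : ∀ x' ∈ X, ∀ y' ∈ Y, L xs ys ls ≤ L x' y' ls)
    -- scaled-form ADMM iterates
    (x : ℕ → Fin n → ℝ) (y : ℕ → Fin q → ℝ) (z : ℕ → Fin m → ℝ)
    (hxX : ∀ k, x k ∈ X) (hyY : ∀ k, y k ∈ Y)
    (hxmin : ∀ k, ∀ x' ∈ X,
      f (x (k + 1)) + ρ / 2 * sqnorm (A.mulVec (x (k + 1)) + B.mulVec (y k) - c + z k) ≤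
        f x' + ρ / 2 * sqnorm (A.mulVec x' + B.mulVec (y k) - c + z k))
    (hymin : ∀ k, ∀ y' ∈ Y,
      g (y (k + 1)) + ρ / 2 * sqnorm (A.mulVec (x (k + 1)) + B.mulVec (y (k + 1)) - c + z k) ≤
        g y' + ρ / 2 * sqnorm (A.mulVec (x (k + 1)) + B.mulVec y' - c + z k))
    (hzupd : ∀ k, z (k + 1) = z k + A.mulVec (x (k + 1)) + B.mulVec (y (k + 1)) - c)
    :
    Tendsto (fun k => f (x k) + g (y k)) atTop (nhds (f xs + g ys)) ∧
    f xs + g ys = sInf {v : ℝ | ∃ x' ∈ X, ∃ y' ∈ Y,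
      A.mulVec x' + B.mulVec y' = c ∧ v = f x' + g y'} := by
  have hLs : ∀ x' y' lam, L x' y' lam =
      f x' + g y' + lam ⬝ᵥ (A.mulVec x' + B.mulVec y' - c) := hL
  set u : Fin m → ℝ := ρ⁻¹ • ls with hu
  have hls : ls = ρ • u := by rw [hu, smul_inv_smul₀ hρ.ne']
  have hfeas : A.mulVec xs + B.mulVec ys = c := by
    have h := hsaddle₁ (ls + (A.mulVec xs + B.mulVec ys - c))
    rw [hLs, hLs, add_dotProduct] at h
    exact sub_eq_zero.1 (dotProduct_self_eq_zero.1
      (le_antisymm (by linarith) (by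
        rw [← sqnorm_eq_dotProduct]; exact sqnorm_nonneg _)))
  have hlower : ∀ x' ∈ X, ∀ y' ∈ Y, f xs + g ys ≤
      f x' + g y' + ρ * (u ⬝ᵥ (A.mulVec x' + B.mulVec y' - c)) := by
    intro x' hx' y' hy'
    have h := hsaddle₂ x' hx' y' hy'
    rw [hLs, hLs, hfeas, sub_self, dotProduct_zero, add_zero, hls, smul_dotProduct,
      smul_eq_mul] at h
    exact h
  constructor
  swap
  · symm
    refine IsLeast.csInf_eq ⟨⟨xs, hxs, ys, hys, hfeas, rfl⟩, ?_⟩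
    rintro _ ⟨x', hx', y', hy', hc, rfl⟩
    simpa [hc] using hlower x' hx' y' hy'
  set r : ℕ → Fin m → ℝ := fun k => A.mulVec (x k) + B.mulVec (y k) - c with hr
  set b : ℕ → Fin m → ℝ := fun k => B.mulVec (y k) - B.mulVec ys with hb
  have hz : ∀ k, z (k + 1) = z k + r (k + 1) := fun k => by
    rw [hzupd, hr]; abel
  have hxopt : ∀ k, f (x (k + 1)) ≤
      f xs + ρ * ((z (k + 1) + (b k - b (k + 1))) ⬝ᵥ (b (k + 1) - r (k + 1))) := by
    intro k
    have h := le_add_dotProduct_of_penalized_min hf hXcv A (hxX (k + 1)) hxs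
      (B.mulVec (y k) - c + z k) (ρ := ρ) (fun x' hx' => by
        simpa only [← add_assoc, ← add_sub_assoc] using hxmin k x' hx')
    have h₁ : A.mulVec (x (k + 1)) + (B.mulVec (y k) - c + z k) =
        z (k + 1) + (b k - b (k + 1)) := by simp only [hz, hr, hb]; abel
    have h₂ : A.mulVec xs - A.mulVec (x (k + 1)) = b (k + 1) - r (k + 1) := by
      simp only [eq_sub_of_add_eq hfeas, hr, hb]; abel
    rwa [h₁, h₂] at h
  have hyopt : ∀ k, ∀ y' ∈ Y, g (y (k + 1)) ≤
      g y' + ρ * (z (k + 1) ⬝ᵥ (B.mulVec y' - B.mulVec (y (k + 1)))) := by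
    intro k y' hy'
    have hcomm : ∀ w : Fin q → ℝ, B.mulVec w + (A.mulVec (x (k + 1)) - c + z k) =
        A.mulVec (x (k + 1)) + B.mulVec w - c + z k := fun w => by abel
    have h := le_add_dotProduct_of_penalized_min hg hYcv B (hyY (k + 1)) hy'
      (A.mulVec (x (k + 1)) - c + z k) (ρ := ρ) (fun w hw => by
        simpa only [hcomm] using hymin k w hw)
    have h₁ : B.mulVec (y (k + 1)) + (A.mulVec (x (k + 1)) - c + z k) = z (k + 1) := by
      simp only [hz, hr]; abel
    rwa [h₁] at h
  have hupper : ∀ k, f (x (k + 1)) + g (y (k + 1)) ≤ f xs + g ys +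
      ρ * ((b k - b (k + 1)) ⬝ᵥ (b (k + 1) - r (k + 1)) - z (k + 1) ⬝ᵥ r (k + 1)) := by
    intro k
    have h₁ := hxopt k
    have h₂ := hyopt k ys hys
    have h₃ : B.mulVec ys - B.mulVec (y (k + 1)) = -b (k + 1) := by simp only [hb]; abel
    rw [h₃, dotProduct_neg] at h₂
    rw [add_dotProduct, dotProduct_sub (z (k + 1))] at h₁
    linarith
  have hmono : ∀ k, 0 ≤ (b (k + 1) - b (k + 2)) ⬝ᵥ r (k + 2) := by
    intro k
    have h₁ : g (y (k + 2)) ≤ g (y (k + 1)) +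
        ρ * (z (k + 2) ⬝ᵥ (B.mulVec (y (k + 1)) - B.mulVec (y (k + 2)))) :=
      hyopt (k + 1) _ (hyY _)
    have hz' : z (k + 2) = z (k + 1) + r (k + 2) := hz (k + 1)
    have h₂ := hyopt k (y (k + 2)) (hyY _)
    have h₃ : B.mulVec (y (k + 1)) - B.mulVec (y (k + 2)) = b (k + 1) - b (k + 2) := by
      simp only [hb]; abel
    have h₄ : B.mulVec (y (k + 2)) - B.mulVec (y (k + 1)) = -(b (k + 1) - b (k + 2)) := by
      simp only [hb]; abel
    rw [h₃, hz', add_dotProduct] at h₁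
    rw [h₄, dotProduct_neg] at h₂
    rw [dotProduct_comm]
    refine nonneg_of_mul_nonneg_right (a := ρ) ?_ hρ
    linarith
  set V : ℕ → ℝ := fun k => sqnorm (z (k + 1) - u) + sqnorm (b (k + 1)) with hV
  have hdesc : ∀ k, V (k + 1) ≤
      V k - (sqnorm (r (k + 2)) + sqnorm (b (k + 1) - b (k + 2))) := by
    intro k
    have h₁ := hupper (k + 1)
    have h₂ := hlower _ (hxX (k + 2)) _ (hyY (k + 2))
    change _ ≤ _ + ρ * (u ⬝ᵥ r (k + 2)) at h₂
    have h₃ := hmono k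
    have h₄ : sqnorm (z (k + 1) - u) =
        sqnorm (z (k + 2) - u) - 2 * ((z (k + 2) - u) ⬝ᵥ r (k + 2)) + sqnorm (r (k + 2)) := by
      have : z (k + 1) - u = (z (k + 2) - u) + (-1 : ℝ) • r (k + 2) := by
        rw [hz (k + 1)]; module
      rw [this, sqnorm_add, sqnorm_smul, dotProduct_smul, smul_eq_mul]
      ring
    have h₅ : sqnorm (b (k + 1)) = sqnorm (b (k + 2)) +
        2 * ((b (k + 1) - b (k + 2)) ⬝ᵥ b (k + 2)) + sqnorm (b (k + 1) - b (k + 2)) := by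
      rw [dotProduct_comm, ← sqnorm_add, add_sub_cancel]
    have h₆ : 0 ≤ (b (k + 1) - b (k + 2)) ⬝ᵥ b (k + 2) -
        (b (k + 1) - b (k + 2)) ⬝ᵥ r (k + 2) - (z (k + 2) - u) ⬝ᵥ r (k + 2) := by
      refine nonneg_of_mul_nonneg_right (a := ρ) ?_ hρ
      rw [dotProduct_sub (b (k + 1) - b (k + 1 + 1))] at h₁
      rw [sub_dotProduct (z (k + 2))]
      linarith
    change sqnorm (z (k + 2) - u) + sqnorm (b (k + 2)) ≤
      sqnorm (z (k + 1) - u) + sqnorm (b (k + 1)) - _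
    linarith
  have hV0 : ∀ k, 0 ≤ V k := fun k => add_nonneg (sqnorm_nonneg _) (sqnorm_nonneg _)
  have hs := tendsto_zero_of_le_sub hV0
    (fun k => add_nonneg (sqnorm_nonneg _) (sqnorm_nonneg _)) hdesc
  have hr0 : Tendsto (fun k => sqnorm (r (k + 2))) atTop (nhds 0) :=
    squeeze_zero (fun k => sqnorm_nonneg _)
      (fun k => le_add_of_nonneg_right (sqnorm_nonneg _)) hs
  have hd0 : Tendsto (fun k => sqnorm (b (k + 1) - b (k + 2))) atTop (nhds 0) :=
    squeeze_zero (fun k => sqnorm_nonneg _)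
      (fun k => le_add_of_nonneg_left (sqnorm_nonneg _)) hs
  have hVle : ∀ k, V (k + 1) ≤ V 0 := fun k =>
    antitone_nat_of_succ_le (fun k => (hdesc k).trans (sub_le_self _
      (add_nonneg (sqnorm_nonneg _) (sqnorm_nonneg _)))) (Nat.zero_le (k + 1))
  have hur : Tendsto (fun k => u ⬝ᵥ r (k + 2)) atTop (nhds 0) :=
    tendsto_dotProduct_zero (fun _ => le_rfl) hr0
  have hzr : Tendsto (fun k => (z (k + 2) - u) ⬝ᵥ r (k + 2)) atTop (nhds 0) :=
    tendsto_dotProduct_zero (fun k => (le_add_of_nonneg_right (sqnorm_nonneg _)).trans (hVle k))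
      hr0
  have hbd : Tendsto (fun k => b (k + 2) ⬝ᵥ (b (k + 1) - b (k + 2))) atTop (nhds 0) :=
    tendsto_dotProduct_zero (fun k => (le_add_of_nonneg_left (sqnorm_nonneg _)).trans (hVle k))
      hd0
  have hdr : Tendsto (fun k => (b (k + 1) - b (k + 2)) ⬝ᵥ r (k + 2)) atTop (nhds 0) := by
    obtain ⟨C, hC⟩ := hd0.bddAbove_range
    exact tendsto_dotProduct_zero (fun k => hC ⟨k, rfl⟩) hr0
  rw [← tendsto_add_atTop_iff_nat 2]
  refine tendsto_of_tendsto_of_tendsto_of_le_of_le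
    (g := fun k => f xs + g ys - ρ * (u ⬝ᵥ r (k + 2)))
    (h := fun k => f xs + g ys + ρ * (b (k + 2) ⬝ᵥ (b (k + 1) - b (k + 2)) -
      (b (k + 1) - b (k + 2)) ⬝ᵥ r (k + 2) - (z (k + 2) - u) ⬝ᵥ r (k + 2) - u ⬝ᵥ r (k + 2)))
    ?_ ?_ ?_ ?_
  · simpa using (hur.const_mul ρ).const_sub (f xs + g ys)
  · simpa using ((((hbd.sub hdr).sub hzr).sub hur).const_mul ρ).const_add (f xs + g ys)
  · intro k
    have h := hlower _ (hxX (k + 2)) _ (hyY (k + 2))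
    exact sub_le_iff_le_add.2 h
  · intro k
    have h := hupper (k + 1)
    rw [dotProduct_sub (b (k + 1) - b (k + 1 + 1))] at h
    refine h.trans (le_of_eq ?_)
    dsimp only
    rw [dotProduct_comm (b (k + 2)), sub_dotProduct (z (k + 2))]
    ring
end

section
/- ADMM dual variable convergence: under the stated assumptions, the unscaled dual iterates λ^k := ρ z^k converge to a dual optimal point, i.e., there exists λ̄ ∈ ℝᵐ such that ρ z^k → λ̄ as k → ∞ and λ̄ maximizes the dual function d(λ) := inf_{x ∈ X, y ∈ Y} L(x,y,λ) over λ ∈ ℝᵐ (where the infimum is taken in the extended reals). -/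
open Matrix Filter

section ADMM

open Topology
open scoped RealInnerProductSpace

variable {E F G : Type*} [NormedAddCommGroup E] [InnerProductSpace ℝ E]
  [AddCommGroup F] [Module ℝ F] [AddCommGroup G] [Module ℝ G]

/-- First-order optimality condition for minimizing a convex function plus a quadratic penalty. -/
theorem ConvexOn.le_add_inner_of_penalty_min {f : F → ℝ} {X : Set F} (hf : ConvexOn ℝ X f)
    (T : F →ₗ[ℝ] E) (d : E) {ρ : ℝ} {x₀ : F} (hx₀ : x₀ ∈ X)
    (hmin : ∀ x ∈ X, f x₀ + ρ / 2 * ‖T x₀ + d‖ ^ 2 ≤ f x + ρ / 2 * ‖T x + d‖ ^ 2)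
    {x : F} (hx : x ∈ X) :
    f x₀ ≤ f x + ρ * ⟪T x₀ + d, T x - T x₀⟫ := by
  have key : ∀ t ∈ Set.Ioo (0 : ℝ) 1,
      0 ≤ f x - f x₀ + ρ * ⟪T x₀ + d, T x - T x₀⟫ + t * (ρ / 2 * ‖T x - T x₀‖ ^ 2) := by
    rintro t ⟨ht0, ht1⟩
    have hc := hf.2 hx₀ hx (sub_nonneg.2 ht1.le) ht0.le (sub_add_cancel 1 t)
    have hm := hmin _ (hf.1 hx₀ hx (sub_nonneg.2 ht1.le) ht0.le (sub_add_cancel 1 t))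
    have hT : T ((1 - t) • x₀ + t • x) + d = (T x₀ + d) + t • (T x - T x₀) := by
      simp only [map_add, map_smul]
      module
    rw [hT, norm_add_sq_real (T x₀ + d), norm_smul, inner_smul_right, mul_pow, Real.norm_eq_abs,
      sq_abs] at hm
    simp only [smul_eq_mul] at hc
    refine nonneg_of_mul_nonneg_right (a := t) ?_ ht0
    linarith
  have hlim : Tendsto (fun t : ℝ ↦ f x - f x₀ + ρ * ⟪T x₀ + d, T x - T x₀⟫
      + t * (ρ / 2 * ‖T x - T x₀‖ ^ 2)) (𝓝[>] 0)
      (𝓝 (f x - f x₀ + ρ * ⟪T x₀ + d, T x - T x₀⟫ + 0 * (ρ / 2 * ‖T x - T x₀‖ ^ 2))) :=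
    Tendsto.mono_left (Continuous.tendsto (by fun_prop) 0) nhdsWithin_le_nhds
  have := ge_of_tendsto hlim (by
    filter_upwards [Ioo_mem_nhdsGT (zero_lt_one' ℝ)] with t ht using key t ht)
  linarith

theorem tendsto_of_norm_sub_sq_le {H : Type*} [SeminormedAddCommGroup H] {u : ℕ → H} {l : H}
    {w : ℕ → ℝ} (hw : Tendsto w atTop (𝓝 0)) (hu : ∀ k, ‖u k - l‖ ^ 2 ≤ w k) : Tendsto u atTop (𝓝 l) := by
  have h := (squeeze_zero (fun k ↦ sq_nonneg ‖u k - l‖) hu hw).sqrt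
  simp only [Real.sqrt_sq (norm_nonneg _), Real.sqrt_zero] at h
  exact tendsto_iff_norm_sub_tendsto_zero.2 h

/-- One ADMM step decreases the distance to a reference point `(z', b')`. -/
theorem admm_step_le {z b z₁ a₁ b₁ c z' b' : E} (hz : z₁ = z + a₁ + b₁ - c)
    (hb : ⟪z₁ - z', b₁ - b'⟫ ≤ 0) (ha : ⟪z₁ - (b₁ - b) - z', a₁ - (c - b')⟫ ≤ 0)
    (hs : ⟪z₁ - z, b₁ - b⟫ ≤ 0) :
    ‖z₁ - z'‖ ^ 2 + ‖b₁ - b'‖ ^ 2 + (‖z₁ - z‖ ^ 2 + ‖b₁ - b‖ ^ 2) ≤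
      ‖z - z'‖ ^ 2 + ‖b - b'‖ ^ 2 := by
  obtain rfl : a₁ = z₁ - z - b₁ + c := by rw [hz]; abel
  have h1 : z - z' = (z₁ - z') - (z₁ - z) := by abel
  have h2 : b - b' = (b₁ - b') - (b₁ - b) := by abel
  have h3 : z₁ - z - b₁ + c - (c - b') = (z₁ - z) - (b₁ - b') := by abel
  have h4 : z₁ - (b₁ - b) - z' = (z₁ - z') - (b₁ - b) := by abel
  rw [h3, h4] at ha
  rw [h1, h2, norm_sub_sq_real (z₁ - z'), norm_sub_sq_real (b₁ - b')]
  generalize z₁ - z' = ζ at *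
  generalize b₁ - b' = β at *
  generalize z₁ - z = r at *
  generalize b₁ - b = δ at *
  simp only [inner_sub_left, inner_sub_right] at ha
  linarith [real_inner_comm β δ, real_inner_comm r δ]

/-- Convergence of sequences satisfying the monotonicity relations of the ADMM iteration. -/
theorem admm_exists_tendsto [FiniteDimensional ℝ E] {a b z : ℕ → E} {c z' b' : E}
    (hz : ∀ k, z (k + 1) = z k + a (k + 1) + b (k + 1) - c)
    (hb : ∀ k l, ⟪z k - z l, b k - b l⟫ ≤ 0)
    (ha : ∀ k l, ⟪z (k + 1) - (b (k + 1) - b k) - (z (l + 1) - (b (l + 1) - b l)),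
      a (k + 1) - a (l + 1)⟫ ≤ 0)
    (hb' : ∀ k, ⟪z k - z', b k - b'⟫ ≤ 0)
    (ha' : ∀ k, ⟪z (k + 1) - (b (k + 1) - b k) - z', a (k + 1) - (c - b')⟫ ≤ 0) :
    ∃ zl bl, Tendsto z atTop (𝓝 zl) ∧ Tendsto b atTop (𝓝 bl) := by
  have hV := fun k ↦ admm_step_le (hz k) (hb' (k + 1)) (ha' k) (hb (k + 1) k)
  set V : ℕ → ℝ := fun k ↦ ‖z k - z'‖ ^ 2 + ‖b k - b'‖ ^ 2 with hVdef
  have hV0 : ∀ k, 0 ≤ V k := fun k ↦ by positivity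
  have hVanti : Antitone V := antitone_nat_of_succ_le fun k ↦ by
    have := hV k
    simp only [hVdef]
    nlinarith [sq_nonneg ‖z (k + 1) - z k‖, sq_nonneg ‖b (k + 1) - b k‖]
  have hVlim := tendsto_atTop_ciInf hVanti ⟨0, by rintro _ ⟨k, rfl⟩; exact hV0 k⟩
  have hdiff : Tendsto (fun k ↦ V k - V (k + 1)) atTop (𝓝 0) := by
    simpa using hVlim.sub ((tendsto_add_atTop_iff_nat 1).2 hVlim)
  have hdz : Tendsto (fun k ↦ z (k + 1) - z k) atTop (𝓝 0) :=
    tendsto_of_norm_sub_sq_le hdiff fun k ↦ by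
      have := hV k
      simp only [hVdef, sub_zero]
      nlinarith [sq_nonneg ‖b (k + 1) - b k‖]
  have hdb : Tendsto (fun k ↦ b (k + 1) - b k) atTop (𝓝 0) :=
    tendsto_of_norm_sub_sq_le hdiff fun k ↦ by
      have := hV k
      simp only [hVdef, sub_zero]
      nlinarith [sq_nonneg ‖z (k + 1) - z k‖]
  have hbdd : ∀ k, (z k, b k) ∈ Metric.closedBall (z', b') √(V 0) := by
    intro k
    have hk : V k ≤ V 0 := hVanti k.zero_le
    simp only [hVdef] at hk
    rw [Metric.mem_closedBall, Prod.dist_eq, dist_eq_norm, dist_eq_norm]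
    refine max_le (Real.le_sqrt_of_sq_le ?_) (Real.le_sqrt_of_sq_le ?_)
    · nlinarith [sq_nonneg ‖b k - b'‖]
    · nlinarith [sq_nonneg ‖z k - z'‖]
  obtain ⟨⟨zl, bl⟩, -, φ, hφ, hlim⟩ :=
    tendsto_subseq_of_bounded Metric.isBounded_closedBall hbdd
  have hzφ : Tendsto (fun j ↦ z (φ j)) atTop (𝓝 zl) := (continuous_fst.tendsto _).comp hlim
  have hbφ : Tendsto (fun j ↦ b (φ j)) atTop (𝓝 bl) := (continuous_snd.tendsto _).comp hlim
  have hdzφ := hdz.comp hφ.tendsto_atTop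
  have hdbφ := hdb.comp hφ.tendsto_atTop
  have hzφ' : Tendsto (fun j ↦ z (φ j + 1)) atTop (𝓝 zl) := by
    simpa [Function.comp_def] using hdzφ.add hzφ
  have hbφ' : Tendsto (fun j ↦ b (φ j + 1)) atTop (𝓝 bl) := by
    simpa [Function.comp_def] using hdbφ.add hbφ
  have haφ' : Tendsto (fun j ↦ a (φ j + 1)) atTop (𝓝 (c - bl)) := by
    have h := (hdzφ.add_const c).sub hbφ'
    rw [zero_add] at h
    refine h.congr fun j ↦ ?_
    simp only [Function.comp_apply, hz (φ j)]
    abel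
  have hbl : ∀ k, ⟪z k - zl, b k - bl⟫ ≤ 0 := fun k ↦
    le_of_tendsto ((hzφ.const_sub (z k)).inner (hbφ.const_sub (b k)))
      (Eventually.of_forall fun j ↦ hb k (φ j))
  have hal : ∀ k, ⟪z (k + 1) - (b (k + 1) - b k) - zl, a (k + 1) - (c - bl)⟫ ≤ 0 := by
    intro k
    have h := hzφ'.sub hdbφ
    rw [sub_zero] at h
    exact le_of_tendsto ((h.const_sub (z (k + 1) - (b (k + 1) - b k))).inner
      (haφ'.const_sub (a (k + 1)))) (Eventually.of_forall fun j ↦ ha k (φ j))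
  have hW := fun k ↦ admm_step_le (hz k) (hbl (k + 1)) (hal k) (hb (k + 1) k)
  set W : ℕ → ℝ := fun k ↦ ‖z k - zl‖ ^ 2 + ‖b k - bl‖ ^ 2 with hWdef
  have hWanti : Antitone W := antitone_nat_of_succ_le fun k ↦ by
    have := hW k
    simp only [hWdef]
    nlinarith [sq_nonneg ‖z (k + 1) - z k‖, sq_nonneg ‖b (k + 1) - b k‖]
  have hW0 : Tendsto W atTop (𝓝 0) := by
    rw [tendsto_iff_tendsto_subseq_of_antitone hWanti hφ.tendsto_atTop]
    simpa [hWdef, Function.comp_def] using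
      ((hzφ.sub_const zl).norm.pow 2).add ((hbφ.sub_const bl).norm.pow 2)
  exact ⟨zl, bl, tendsto_of_norm_sub_sq_le hW0 fun k ↦ le_add_of_nonneg_right (sq_nonneg _),
    tendsto_of_norm_sub_sq_le hW0 fun k ↦ le_add_of_nonneg_left (sq_nonneg _)⟩

/-- Convergence of the scaled ADMM multipliers to a multiplier `zl` for which `ρ • zl` certifies
the saddle value, for linear constraints `T x + S y = c`. -/
theorem admm_exists_tendsto_multiplier [FiniteDimensional ℝ E] {f : F → ℝ} {g : G → ℝ}
    {X : Set F} {Y : Set G} (hf : ConvexOn ℝ X f) (hg : ConvexOn ℝ Y g)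
    (T : F →ₗ[ℝ] E) (S : G →ₗ[ℝ] E) {c : E} {ρ : ℝ} (hρ : 0 < ρ)
    {xs : F} {ys : G} {ls : E} (hxs : xs ∈ X) (hys : ys ∈ Y) (hfeas : T xs + S ys = c)
    (hsaddle : ∀ x ∈ X, ∀ y ∈ Y, f xs + g ys ≤ f x + g y + ⟪ls, T x + S y - c⟫)
    {x : ℕ → F} {y : ℕ → G} {z : ℕ → E} (hxX : ∀ k, x k ∈ X) (hyY : ∀ k, y k ∈ Y)
    (hxmin : ∀ k, ∀ x' ∈ X, f (x (k + 1)) + ρ / 2 * ‖T (x (k + 1)) + (S (y k) - c + z k)‖ ^ 2 ≤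
      f x' + ρ / 2 * ‖T x' + (S (y k) - c + z k)‖ ^ 2)
    (hymin : ∀ k, ∀ y' ∈ Y,
      g (y (k + 1)) + ρ / 2 * ‖S (y (k + 1)) + (T (x (k + 1)) - c + z k)‖ ^ 2 ≤
        g y' + ρ / 2 * ‖S y' + (T (x (k + 1)) - c + z k)‖ ^ 2)
    (hz : ∀ k, z (k + 1) = z k + T (x (k + 1)) + S (y (k + 1)) - c) :
    ∃ zl, Tendsto z atTop (𝓝 zl) ∧
      ∀ x' ∈ X, ∀ y' ∈ Y, f xs + g ys ≤ f x' + g y' + ⟪ρ • zl, T x' + S y' - c⟫ := by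
  have hx : ∀ k, ∀ x' ∈ X, f (x (k + 1)) ≤ f x' +
      ρ * ⟪z (k + 1) - (S (y (k + 1)) - S (y k)), T x' - T (x (k + 1))⟫ := by
    intro k x' hx'
    convert hf.le_add_inner_of_penalty_min T _ (hxX _) (hxmin k) hx' using 4
    rw [hz k]
    abel
  have hy : ∀ k, ∀ y' ∈ Y, g (y (k + 1)) ≤ g y' + ρ * ⟪z (k + 1), S y' - S (y (k + 1))⟫ := by
    intro k y' hy'
    convert hg.le_add_inner_of_penalty_min S _ (hyY _) (hymin k) hy' using 4
    rw [hz k]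
    abel
  have hls : ∀ v : E, ⟪ls, v⟫ = ρ * ⟪ρ⁻¹ • ls, v⟫ := fun v ↦ by
    rw [real_inner_smul_left, mul_inv_cancel_left₀ hρ.ne']
  have hxs' : ∀ x' ∈ X, f xs ≤ f x' + ρ * ⟪ρ⁻¹ • ls, T x' - T xs⟫ := fun x' hx' ↦ by
    have h := hsaddle x' hx' ys hys
    rw [← hfeas, add_sub_add_right_eq_sub, hls] at h
    linarith
  have hys' : ∀ y' ∈ Y, g ys ≤ g y' + ρ * ⟪ρ⁻¹ • ls, S y' - S ys⟫ := fun y' hy' ↦ by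
    have h := hsaddle xs hxs y' hy'
    rw [← hfeas, add_sub_add_left_eq_sub, hls] at h
    linarith
  have mono : ∀ {p q : ℝ} {u v s t : E}, p ≤ q + ρ * ⟪u, t - s⟫ → q ≤ p + ρ * ⟪v, s - t⟫ →
      ⟪u - v, s - t⟫ ≤ 0 := by
    intro p q u v s t h1 h2
    refine nonpos_of_mul_nonpos_right (a := ρ) ?_ hρ
    rw [inner_sub_left]
    rw [← neg_sub s t, inner_neg_right] at h1
    linarith
  obtain ⟨zl, bl, hzl, hbl⟩ := admm_exists_tendsto (a := fun k ↦ T (x (k + 1)))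
    (b := fun k ↦ S (y (k + 1))) (z := fun k ↦ z (k + 1)) (c := c) (z' := ρ⁻¹ • ls)
    (b' := S ys) (fun k ↦ hz (k + 1))
    (fun k l ↦ mono (hy k _ (hyY _)) (hy l _ (hyY _)))
    (fun k l ↦ mono (hx (k + 1) _ (hxX _)) (hx (l + 1) _ (hxX _)))
    (fun k ↦ mono (hy k _ hys) (hys' _ (hyY _)))
    (fun k ↦ by
      rw [← eq_sub_iff_add_eq.2 hfeas]
      exact mono (hx (k + 1) _ hxs) (hxs' _ (hxX _)))
  have hzl' : Tendsto z atTop (𝓝 zl) := (tendsto_add_atTop_iff_nat 1).1 hzl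
  have hbl' : Tendsto (fun k ↦ S (y k)) atTop (𝓝 bl) :=
    (tendsto_add_atTop_iff_nat (f := fun k ↦ S (y k)) 1).1 hbl
  have hal : Tendsto (fun k ↦ T (x (k + 1))) atTop (𝓝 (c - bl)) := by
    have h := ((hzl.sub hzl').add_const c).sub hbl
    rw [sub_self, zero_add] at h
    refine h.congr fun k ↦ ?_
    rw [hz k]
    abel
  refine ⟨zl, hzl', fun x' hx' y' hy' ↦ ?_⟩
  have hlim₁ : Tendsto (fun k ↦ f xs + g ys - ⟪ls, T (x (k + 1)) + S (y (k + 1)) - c⟫) atTop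
      (𝓝 (f xs + g ys - ⟪ls, c - bl + bl - c⟫)) :=
    (tendsto_const_nhds.inner ((hal.add hbl).sub_const c)).const_sub _
  have hlim₂ : Tendsto (fun k ↦ f x' + ρ * ⟪z (k + 1) - (S (y (k + 1)) - S (y k)),
        T x' - T (x (k + 1))⟫ + (g y' + ρ * ⟪z (k + 1), S y' - S (y (k + 1))⟫)) atTop
      (𝓝 (f x' + ρ * ⟪zl - (bl - bl), T x' - (c - bl)⟫ + (g y' + ρ * ⟪zl, S y' - bl⟫))) :=
    ((((hzl.sub (hbl.sub hbl')).inner (hal.const_sub _)).const_mul ρ).const_add _).add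
      (((hzl.inner (hbl.const_sub _)).const_mul ρ).const_add _)
  have h := le_of_tendsto_of_tendsto' hlim₁ hlim₂ fun k ↦ by
    linarith [hx k x' hx', hy k y' hy', hsaddle _ (hxX (k + 1)) _ (hyY (k + 1))]
  simp only [sub_add_cancel, sub_self, inner_zero_right, sub_zero] at h
  have e : T x' + S y' - c = (T x' - (c - bl)) + (S y' - bl) := by abel
  rw [e, real_inner_smul_left, inner_add_right]
  linarith

end ADMM

/-- ADMM dual variable convergence. Under the stated assumptions, the
unscaled dual iterates `ρ z^k` converge to a maximizer of the dual function
`d(λ) = inf_{x ∈ X, y ∈ Y} L(x, y, λ)` (infimum taken in the extended reals). -/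
theorem admm_dual_convergence
    {n q m : ℕ}
    (f : (Fin n → ℝ) → ℝ) (g : (Fin q → ℝ) → ℝ)
    (hf : ConvexOn ℝ Set.univ f) (hg : ConvexOn ℝ Set.univ g)
    (X : Set (Fin n → ℝ)) (Y : Set (Fin q → ℝ))
    (hXne : X.Nonempty) (hXcl : IsClosed X) (hXcv : Convex ℝ X)
    (hYne : Y.Nonempty) (hYcl : IsClosed Y) (hYcv : Convex ℝ Y)
    (A : Matrix (Fin m) (Fin n) ℝ) (B : Matrix (Fin m) (Fin q) ℝ)
    (c : Fin m → ℝ) (ρ : ℝ) (hρ : 0 < ρ)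
    -- the (unaugmented) Lagrangian
    (L : (Fin n → ℝ) → (Fin q → ℝ) → (Fin m → ℝ) → ℝ)
    (hL : ∀ x' y' lam, L x' y' lam =
      f x' + g y' + ∑ i, lam i * (A.mulVec x' + B.mulVec y' - c) i)
    -- saddle point of the Lagrangian
    (xs : Fin n → ℝ) (ys : Fin q → ℝ) (ls : Fin m → ℝ)
    (hxs : xs ∈ X) (hys : ys ∈ Y)
    (hsaddle₁ : ∀ lam : Fin m → ℝ, L xs ys lam ≤ L xs ys ls)
    (hsaddle₂ : ∀ x' ∈ X, ∀ y' ∈ Y, L xs ys ls ≤ L x' y' ls)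
    -- scaled-form ADMM iterates
    (x : ℕ → Fin n → ℝ) (y : ℕ → Fin q → ℝ) (z : ℕ → Fin m → ℝ)
    (hxX : ∀ k, x k ∈ X) (hyY : ∀ k, y k ∈ Y)
    (hxmin : ∀ k, ∀ x' ∈ X,
      f (x (k + 1)) + ρ / 2 * sqnorm (A.mulVec (x (k + 1)) + B.mulVec (y k) - c + z k) ≤
        f x' + ρ / 2 * sqnorm (A.mulVec x' + B.mulVec (y k) - c + z k))
    (hymin : ∀ k, ∀ y' ∈ Y,
      g (y (k + 1)) + ρ / 2 * sqnorm (A.mulVec (x (k + 1)) + B.mulVec (y (k + 1)) - c + z k) ≤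
        g y' + ρ / 2 * sqnorm (A.mulVec (x (k + 1)) + B.mulVec y' - c + z k))
    (hzupd : ∀ k, z (k + 1) = z k + A.mulVec (x (k + 1)) + B.mulVec (y (k + 1)) - c)
    :
    ∃ lb : Fin m → ℝ,
      Tendsto (fun k => ρ • z k) atTop (nhds lb) ∧
      ∀ lam : Fin m → ℝ,
        sInf {v : EReal | ∃ x' ∈ X, ∃ y' ∈ Y, v = (L x' y' lam : ℝ)} ≤
          sInf {v : EReal | ∃ x' ∈ X, ∃ y' ∈ Y, v = (L x' y' lb : ℝ)} := by
  let e := (WithLp.linearEquiv 2 ℝ (Fin m → ℝ)).symm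
  have he : ∀ v, e v = WithLp.toLp 2 v := fun _ ↦ rfl
  have hsq : ∀ v : Fin m → ℝ, sqnorm v = ‖e v‖ ^ 2 := fun v ↦ by
    simp [he, sqnorm, EuclideanSpace.real_norm_sq_eq]
  have hin : ∀ u v : Fin m → ℝ, ∑ i, u i * v i = inner ℝ (e u) (e v) := fun u v ↦ by
    simp [he, PiLp.inner_apply, mul_comm]
  have hfeas : A.mulVec xs + B.mulVec ys - c = 0 := by
    have h := hsaddle₁ (ls + (A.mulVec xs + B.mulVec ys - c))
    simp only [hL, hin, map_add e ls, inner_add_left, real_inner_self_eq_norm_sq] at h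
    have h0 : ‖e (A.mulVec xs + B.mulVec ys - c)‖ ^ 2 ≤ 0 := by linarith
    exact e.map_eq_zero_iff.1 (norm_eq_zero.1 (sq_eq_zero_iff.1 (le_antisymm h0 (sq_nonneg _))))
  have hLs : ∀ lam, L xs ys lam = f xs + g ys := fun lam ↦ by
    rw [hL, hfeas]
    simp
  let T := e.toLinearMap ∘ₗ A.mulVecLin
  let S := e.toLinearMap ∘ₗ B.mulVecLin
  have hT : ∀ v, T v = e (A.mulVec v) := fun _ ↦ rfl
  have hS : ∀ v, S v = e (B.mulVec v) := fun _ ↦ rfl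
  have hpenT : ∀ x' y' w, sqnorm (A.mulVec x' + B.mulVec y' - c + w) =
      ‖T x' + (S y' - e c + e w)‖ ^ 2 := fun x' y' w ↦ by
    rw [hsq, hT, hS, ← map_sub, ← map_add, ← map_add]
    congr 3
    abel
  have hpenS : ∀ x' y' w, sqnorm (A.mulVec x' + B.mulVec y' - c + w) =
      ‖S y' + (T x' - e c + e w)‖ ^ 2 := fun x' y' w ↦ by
    rw [hsq, hT, hS, ← map_sub, ← map_add, ← map_add]
    congr 3
    abel
  have hres : ∀ x' y', e (A.mulVec x' + B.mulVec y' - c) = T x' + S y' - e c := fun x' y' ↦ by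
    rw [map_sub, map_add, hT, hS]
  obtain ⟨zl, hzl, hcert⟩ := admm_exists_tendsto_multiplier
    (hf.subset (Set.subset_univ X) hXcv) (hg.subset (Set.subset_univ Y) hYcv)
    T S (c := e c) hρ (ls := e ls) hxs hys
    (sub_eq_zero.1 (by rw [← hres, hfeas, map_zero]))
    (fun x' hx' y' hy' ↦ by simpa only [hLs, hL, hin, hres] using hsaddle₂ x' hx' y' hy')
    (z := fun k ↦ e (z k)) hxX hyY
    (fun k x' hx' ↦ by simpa only [hpenT] using hxmin k x' hx')
    (fun k y' hy' ↦ by simpa only [hpenS] using hymin k y' hy')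
    (fun k ↦ by simp only [hzupd k, map_sub, map_add, hT, hS])
  refine ⟨ρ • e.symm zl, ?_, fun lam ↦ ?_⟩
  · exact (((PiLp.continuous_ofLp 2 _).tendsto zl).comp hzl).const_smul ρ
  · have hle : ∀ x' ∈ X, ∀ y' ∈ Y, L xs ys lam ≤ L x' y' (ρ • e.symm zl) := by
      intro x' hx' y' hy'
      rw [hLs, hL, hin, hres, map_smul, e.apply_symm_apply]
      exact hcert x' hx' y' hy'
    refine le_trans (b := (L xs ys lam : EReal)) (sInf_le ⟨xs, hxs, ys, hys, rfl⟩) (le_sInf ?_)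
    rintro _ ⟨x', hx', y', hy', rfl⟩
    exact EReal.coe_le_coe_iff.2 (hle x' hx' y' hy')
end

section
/- Convergence of the DLMPC ADMM scheme (Corollary 2.1): under the stated assumptions, any ADMM iterate sequences Φ^k, Ψ^k, Λ^k ∈ ℝ^{q×n} satisfying (i) Φ^{k+1} minimizes Φ ↦ f(Φx0) + (ρ/2)‖Φ − Ψ^k + Λ^k‖_F² over {Φ ∈ L : Φx0 ∈ P}, (ii) Ψ^{k+1} minimizes Ψ ↦ ‖Φ^{k+1} − Ψ + Λ^k‖_F² over {Ψ ∈ L : ZΨ = C}, and (iii) Λ^{k+1} = Λ^k + Φ^{k+1} − Ψ^{k+1}, satisfy: the residual Φ^k − Ψ^k converges to the zero matrix, the objective values f(Φ^k x0) converge to the optimal value p*, and the sequence of unscaled dual variables ρΛ^k converges. -/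
open Matrix Filter

/-- Squared Frobenius norm of a real matrix. -/
noncomputable def frobSq {q n : ℕ} (M : Matrix (Fin q) (Fin n) ℝ) : ℝ :=
  ∑ i, ∑ j, (M i j) ^ 2

theorem exists_linearMap_nonneg_add {F : Type*} [AddCommGroup F] [Module ℝ F]
    {S : Set (F × ℝ)} (hS : Convex ℝ S) (h0 : (0 : F × ℝ) ∈ S)
    (hnn : ∀ t : ℝ, ((0 : F), t) ∈ S → 0 ≤ t)
    (hneg : ∀ d t, (d, t) ∈ S → ∃ ε > (0 : ℝ), ∃ t', (-(ε • d), t') ∈ S) :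
    ∃ l : F →ₗ[ℝ] ℝ, ∀ d t, (d, t) ∈ S → 0 ≤ l d + t := by
  let K : PointedCone ℝ (F × ℝ) := (ConvexCone.hull ℝ S).toPointedCone (ConvexCone.subset_hull h0)
  have hK : ∀ x, x ∈ K ↔ ∃ c : ℝ, 0 < c ∧ ∃ y ∈ S, c • y = x := fun x =>
    ConvexCone.mem_hull_of_convex hS
  let W : Submodule ℝ F := Submodule.span ℝ (Prod.fst '' S)
  have hsmul : ∀ (c : ℝ) (x : F × ℝ), 0 ≤ c → x ∈ K → c • x ∈ K := fun c x hc hx =>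
    K.smul_mem hc hx
  have hKneg : ∀ w t, (w, t) ∈ K → ∃ t', (-w, t') ∈ K := by
    intro w t h
    obtain ⟨c, hc, ⟨d, u⟩, hd, he⟩ := (hK _).1 h
    obtain ⟨ε, hε, t', ht'⟩ := hneg d u hd
    simp only [Prod.smul_mk, Prod.mk.injEq] at he
    refine ⟨(c / ε) * t', (hK _).2 ⟨c / ε, div_pos hc hε, _, ht', ?_⟩⟩
    simp [smul_smul, div_mul_cancel₀ _ hε.ne', he.1]
  have hKW : ∀ w ∈ W, ∃ t, (w, t) ∈ K := by
    intro w hw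
    induction hw using Submodule.span_induction with
    | mem x hx =>
      obtain ⟨⟨d, t⟩, h, rfl⟩ := hx
      exact ⟨t, (hK _).2 ⟨1, one_pos, _, h, by simp⟩⟩
    | zero => exact ⟨0, K.zero_mem⟩
    | add x y _ _ hx hy =>
      obtain ⟨t, ht⟩ := hx
      obtain ⟨u, hu⟩ := hy
      exact ⟨t + u, K.add_mem ht hu⟩
    | smul a x _ hx =>
      obtain ⟨t, ht⟩ := hx
      rcases le_total 0 a with ha | ha
      · exact ⟨a * t, hsmul a _ ha ht⟩
      · obtain ⟨u, hu⟩ := hKneg _ _ ht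
        refine ⟨-a * u, ?_⟩
        have := hsmul (-a) _ (neg_nonneg.2 ha) hu
        simpa using this
  obtain ⟨Q, hQ⟩ := W.exists_isCompl
  let φ : (F × ℝ) →ₗ.[ℝ] ℝ :=
    { domain := Q.prod ⊤
      toFun := (LinearMap.snd ℝ F ℝ).comp (Submodule.subtype _) }
  have hφ : ∀ x : φ.domain, φ x = (x : F × ℝ).2 := fun x => rfl
  obtain ⟨G, hG, hGnn⟩ := riesz_extension K φ
    (by
      rintro ⟨⟨d, t⟩, hd⟩ hmem
      rw [hφ]
      obtain ⟨c, hc, ⟨y, u⟩, hy, he⟩ := (hK _).1 hmem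
      simp only [Prod.smul_mk, Prod.mk.injEq] at he
      have hyW : c • y ∈ W := W.smul_mem _ (Submodule.subset_span ⟨_, hy, rfl⟩)
      have hd0 : d = 0 := Submodule.disjoint_def.1 hQ.disjoint d (he.1 ▸ hyW) hd.1
      have hy0 : y = 0 := by
        have := he.1.trans hd0
        exact (smul_eq_zero.1 this).resolve_left hc.ne'
      subst hy0
      have := hnn u hy
      simp only [← he.2]
      exact mul_nonneg hc.le this)
    (by
      rintro ⟨d, t⟩
      have hd : d ∈ W ⊔ Q := hQ.sup_eq_top ▸ Submodule.mem_top
      obtain ⟨w, hw, q, hq, rfl⟩ := Submodule.mem_sup.1 hd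
      obtain ⟨u, hu⟩ := hKW w hw
      refine ⟨⟨(-q, u - t), Q.neg_mem hq, trivial⟩, ?_⟩
      simpa using hu)
  refine ⟨G.comp (LinearMap.inl ℝ F ℝ), fun d t h => ?_⟩
  have h1 := hGnn (d, t) ((hK _).2 ⟨1, one_pos, _, h, by simp⟩)
  have h2 : G (0, t) = t := hG ⟨(0, t), Q.zero_mem, trivial⟩
  have h3 : (d, t) = (d, (0 : ℝ)) + ((0 : F), t) := by simp
  rw [h3, map_add, h2] at h1
  simpa using h1

theorem exists_mem_lineMap_of_mem_intrinsicInterior {V : Type*} [NormedAddCommGroup V]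
    [NormedSpace ℝ V] {P : Set V} {a p : V} (ha : a ∈ intrinsicInterior ℝ P) (hp : p ∈ P) :
    ∃ ε > (0 : ℝ), a + ε • (a - p) ∈ P := by
  obtain ⟨y, hy, rfl⟩ := mem_intrinsicInterior.1 ha
  let γ : ℝ → affineSpan ℝ P := fun t =>
    ⟨AffineMap.lineMap (y : V) p (-t), AffineMap.lineMap_mem _ y.2 (subset_affineSpan ℝ P hp)⟩
  have hγ : Continuous γ := by
    refine Continuous.subtype_mk ?_ _
    simp only [AffineMap.lineMap_apply_module']
    fun_prop
  have hγ0 : γ 0 = y := by ext; simp [γ]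
  have hnhds : ∀ᶠ t in nhds (0 : ℝ), γ t ∈ ((↑) ⁻¹' P : Set (affineSpan ℝ P)) :=
    hγ.continuousAt.eventually (by rw [hγ0]; exact mem_interior_iff_mem_nhds.1 hy)
  obtain ⟨ε, hε, hpos⟩ :=
    ((hnhds.filter_mono nhdsWithin_le_nhds).and (self_mem_nhdsWithin (s := Set.Ioi (0 : ℝ)))).exists
  refine ⟨ε, hpos, ?_⟩
  have : (γ ε : V) ∈ P := hε
  convert this using 1
  simp only [γ, AffineMap.lineMap_apply_module']
  module

section InnerProduct

variable {E : Type*} [NormedAddCommGroup E] [InnerProductSpace ℝ E]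

theorem exists_multiplier_of_relative_slater [FiniteDimensional ℝ E] {A B : Set E}
    (hA : Convex ℝ A) (hB : Convex ℝ B) {g : E → ℝ} (hg : ConvexOn ℝ A g) {a : E}
    (haA : a ∈ A) (haB : a ∈ B) (hmin : ∀ x ∈ A, x ∈ B → g a ≤ g x)
    (hslater : ∃ b, ∀ x ∈ A, ∀ z ∈ B, ∃ ε > (0 : ℝ), b + ε • (b - x) ∈ A ∧ b + ε • (b - z) ∈ B) :
    ∃ w : E, ∀ x ∈ A, ∀ z ∈ B, g a ≤ g x + inner ℝ w (x - z) := by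
  let S : Set (E × ℝ) := {v | ∃ x ∈ A, ∃ z ∈ B, v.1 = x - z ∧ g x - g a ≤ v.2}
  have hS : Convex ℝ S := by
    rintro ⟨d, t⟩ ⟨x, hx, z, hz, hd, ht⟩ ⟨d', t'⟩ ⟨x', hx', z', hz', hd', ht'⟩ α β hα hβ hαβ
    refine ⟨_, hA hx hx' hα hβ hαβ, _, hB hz hz' hα hβ hαβ, ?_, ?_⟩
    · simp only at hd hd'
      simp only [Prod.smul_mk, Prod.mk_add_mk, hd, hd']
      module
    · have := hg.2 hx hx' hα hβ hαβ
      simp only [smul_eq_mul, Prod.smul_mk, Prod.mk_add_mk] at *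
      have e : g a = α * g a + β * g a := by rw [← add_mul, hαβ, one_mul]
      nlinarith [mul_le_mul_of_nonneg_left ht hα, mul_le_mul_of_nonneg_left ht' hβ]
  obtain ⟨l, hl⟩ := exists_linearMap_nonneg_add hS ⟨a, haA, a, haB, by simp, by simp⟩
    (by
      rintro t ⟨x, hx, z, hz, hd, ht⟩
      obtain rfl : x = z := (sub_eq_zero.1 hd.symm)
      have := hmin x hx hz
      simp only at ht
      linarith)
    (by
      rintro d t ⟨x, hx, z, hz, hd, ht⟩
      obtain ⟨b, hb⟩ := hslater
      obtain ⟨ε, hε, h1, h2⟩ := hb x hx z hz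
      refine ⟨ε, hε, _, _, h1, _, h2, ?_, le_rfl⟩
      simp only at hd
      simp only [hd]
      module)
  refine ⟨(InnerProductSpace.toDual ℝ E).symm (LinearMap.toContinuousLinearMap l), ?_⟩
  intro x hx z hz
  have := hl (x - z) (g x - g a) ⟨x, hx, z, hz, rfl, le_rfl⟩
  rw [InnerProductSpace.toDual_symm_apply]
  simp only [LinearMap.coe_toContinuousLinearMap']
  linarith

theorem ConvexOn.variational_of_prox_le {A : Set E} {g : E → ℝ} (hg : ConvexOn ℝ A g) {ρ : ℝ}
    {x c : E} (hx : x ∈ A)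
    (hmin : ∀ y ∈ A, g x + ρ / 2 * ‖x - c‖ ^ 2 ≤ g y + ρ / 2 * ‖y - c‖ ^ 2) :
    ∀ y ∈ A, g x ≤ g y + ρ * inner ℝ (x - c) (y - x) := by
  intro y hy
  have key : ∀ t ∈ Set.Ioo (0 : ℝ) 1,
      g x ≤ g y + ρ * inner ℝ (x - c) (y - x) + t * (ρ / 2 * ‖y - x‖ ^ 2) := by
    rintro t ⟨ht0, ht1⟩
    have h1 := hmin _ (hg.1 hx hy (sub_nonneg.2 ht1.le) ht0.le (by ring))
    have h2 := hg.2 hx hy (sub_nonneg.2 ht1.le) ht0.le (by ring)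
    have e : (1 - t) • x + t • y - c = (x - c) + t • (y - x) := by module
    rw [e, norm_add_sq_real, inner_smul_right, norm_smul, mul_pow, Real.norm_eq_abs, sq_abs] at h1
    simp only [smul_eq_mul] at h2
    refine le_of_mul_le_mul_left ?_ ht0
    nlinarith
  have hlim : Tendsto (fun t : ℝ => g y + ρ * inner ℝ (x - c) (y - x) + t * (ρ / 2 * ‖y - x‖ ^ 2))
      (nhdsWithin 0 (Set.Ioi 0)) (nhds (g y + ρ * inner ℝ (x - c) (y - x))) := by
    have : Continuous fun t : ℝ =>
        g y + ρ * inner ℝ (x - c) (y - x) + t * (ρ / 2 * ‖y - x‖ ^ 2) := by fun_prop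
    simpa using (this.tendsto 0).mono_left nhdsWithin_le_nhds
  refine ge_of_tendsto hlim ?_
  filter_upwards [Ioo_mem_nhdsGT (zero_lt_one' ℝ)] with t ht using key t ht

/-- A pair consisting of a primal minimizer of `g` over `A ∩ B` and a scaled multiplier. -/
def IsScaledSaddle (A B : Set E) (g : E → ℝ) (ρ : ℝ) (a w : E) : Prop :=
  a ∈ A ∧ a ∈ B ∧ ∀ x ∈ A, ∀ z ∈ B, g a ≤ g x + ρ * inner ℝ w (x - z)

theorem IsScaledSaddle.lyapunov_le {A B : Set E} {g : E → ℝ} {ρ : ℝ} (hρ : 0 < ρ) {a w : E}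
    (h : IsScaledSaddle A B g ρ a w) {x z u z' u' : E} (hx : x ∈ A) (hz : z ∈ B) (hz' : z' ∈ B)
    (hu : u = u' + x - z)
    (h1 : ∀ y ∈ A, g x ≤ g y + ρ * inner ℝ (u + (z - z')) (y - x))
    (h2 : ∀ y ∈ B, inner ℝ u (y - z) ≤ 0) (h3 : ∀ y ∈ B, inner ℝ u' (y - z') ≤ 0) :
    (‖u - w‖ ^ 2 + ‖z - a‖ ^ 2) + (‖u - u'‖ ^ 2 + ‖z - z'‖ ^ 2) ≤
      ‖u' - w‖ ^ 2 + ‖z' - a‖ ^ 2 := by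
  obtain ⟨haA, haB, hs⟩ := h
  have e1 := h1 a haA
  have e2 := h2 a haB
  have e3 := h2 z' hz'
  have e4 := h3 z hz
  have e5 : 0 ≤ inner ℝ (u + (z - z')) (a - x) + inner ℝ w (x - z) := by
    have := hs x hx z hz
    refine nonneg_of_mul_nonneg_right ?_ hρ
    linarith
  obtain rfl : x = u - u' + z := by rw [hu]; abel
  simp only [← real_inner_self_eq_norm_sq]
  simp only [inner_add_left, inner_sub_left, inner_add_right, inner_sub_right] at *
  simp only [real_inner_comm u' u, real_inner_comm z u, real_inner_comm z' u, real_inner_comm a u,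
    real_inner_comm w u, real_inner_comm z u', real_inner_comm z' u',
    real_inner_comm w u', real_inner_comm z' z, real_inner_comm a z, real_inner_comm a z'] at *
  linarith

/-- Convergence of ADMM for minimizing `g` over `A ∩ B`, given a saddle point. -/
theorem admm_tendsto [FiniteDimensional ℝ E] {A B : Set E} (hA : IsClosed A) (hB : IsClosed B)
    {g : E → ℝ} (hg : Continuous g) {ρ : ℝ} (hρ : 0 < ρ) {x z u : ℕ → E}
    (hx : ∀ k, x k ∈ A) (hz : ∀ k, z k ∈ B) (hu : ∀ k, u (k + 1) = u k + x (k + 1) - z (k + 1))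
    (h1 : ∀ k, ∀ y ∈ A,
      g (x (k + 1)) ≤ g y + ρ * inner ℝ (u (k + 1) + (z (k + 1) - z k)) (y - x (k + 1)))
    (h2 : ∀ k, ∀ y ∈ B, inner ℝ (u k) (y - z k) ≤ 0)
    (hex : ∃ a w, IsScaledSaddle A B g ρ a w) :
    ∃ a w, IsScaledSaddle A B g ρ a w ∧ Tendsto x atTop (nhds a) ∧ Tendsto z atTop (nhds a) ∧
      Tendsto u atTop (nhds w) := by
  let V : E → E → ℕ → ℝ := fun a w k => ‖u k - w‖ ^ 2 + ‖z k - a‖ ^ 2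
  have hV0 : ∀ a w k, 0 ≤ V a w k := fun a w k => by positivity
  have hdesc : ∀ a w, IsScaledSaddle A B g ρ a w → ∀ k,
      V a w (k + 1) + (‖u (k + 1) - u k‖ ^ 2 + ‖z (k + 1) - z k‖ ^ 2) ≤ V a w k :=
    fun a w h k => h.lyapunov_le hρ (hx _) (hz _) (hz _) (hu k) (h1 k) (h2 _) (h2 _)
  have hanti : ∀ a w, IsScaledSaddle A B g ρ a w → Antitone (V a w) := fun a w h =>
    antitone_nat_of_succ_le fun k => le_trans (le_add_of_nonneg_right (by positivity))
      (hdesc a w h k)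
  obtain ⟨a₀, w₀, h₀⟩ := hex
  have hdiff : Tendsto (fun k => V a₀ w₀ k - V a₀ w₀ (k + 1)) atTop (nhds 0) := by
    have := tendsto_atTop_ciInf (hanti _ _ h₀) ⟨0, by rintro _ ⟨k, rfl⟩; exact hV0 _ _ k⟩
    simpa using this.sub ((tendsto_add_atTop_iff_nat 1).2 this)
  have hsq : ∀ v : ℕ → E, (∀ k, ‖v k‖ ^ 2 ≤ V a₀ w₀ k - V a₀ w₀ (k + 1)) →
      Tendsto v atTop (nhds 0) := by
    intro v hv
    have h := (squeeze_zero (fun k => sq_nonneg ‖v k‖) hv hdiff).sqrt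
    rw [tendsto_zero_iff_norm_tendsto_zero]
    simpa using h
  have hdu : Tendsto (fun k => u (k + 1) - u k) atTop (nhds 0) := hsq _ fun k => by
    have := hdesc _ _ h₀ k
    have := sq_nonneg ‖z (k + 1) - z k‖
    linarith
  have hdz : Tendsto (fun k => z (k + 1) - z k) atTop (nhds 0) := hsq _ fun k => by
    have := hdesc _ _ h₀ k
    have := sq_nonneg ‖u (k + 1) - u k‖
    linarith
  have hcpt : IsCompact (Metric.closedBall a₀ √(V a₀ w₀ 0) ×ˢ Metric.closedBall w₀ √(V a₀ w₀ 0)) :=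
    (isCompact_closedBall _ _).prod (isCompact_closedBall _ _)
  obtain ⟨⟨a, w⟩, -, φ, hφ, hlim⟩ := hcpt.tendsto_subseq (x := fun k => (z (k + 1), u (k + 1)))
    (by
      intro k
      have hle := hanti _ _ h₀ (Nat.zero_le (k + 1))
      simp only [Set.mem_prod, mem_closedBall_iff_norm]
      constructor <;> refine Real.le_sqrt_of_sq_le (le_trans ?_ hle)
      · exact le_add_of_nonneg_left (sq_nonneg _)
      · exact le_add_of_nonneg_right (sq_nonneg _))
  have hzφ : Tendsto (fun j => z (φ j + 1)) atTop (nhds a) := (continuous_fst.tendsto _).comp hlim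
  have huφ : Tendsto (fun j => u (φ j + 1)) atTop (nhds w) := (continuous_snd.tendsto _).comp hlim
  have hxe : ∀ k, x (k + 1) = (u (k + 1) - u k) + z (k + 1) := fun k => by rw [hu]; abel
  have hxφ : Tendsto (fun j => x (φ j + 1)) atTop (nhds a) := by
    simpa only [hxe, Function.comp_def, zero_add] using (hdu.comp hφ.tendsto_atTop).add hzφ
  have hsaddle : IsScaledSaddle A B g ρ a w := by
    refine ⟨hA.mem_of_tendsto hxφ (.of_forall fun j => hx _),
      hB.mem_of_tendsto hzφ (.of_forall fun j => hz _), fun y hy v hv => ?_⟩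
    have l1 : g a ≤ g y + ρ * inner ℝ (w + 0) (y - a) :=
      le_of_tendsto_of_tendsto' ((hg.tendsto a).comp hxφ)
        (tendsto_const_nhds.add (tendsto_const_nhds.mul
          ((huφ.add (hdz.comp hφ.tendsto_atTop)).inner (tendsto_const_nhds.sub hxφ))))
        fun j => h1 (φ j) y hy
    have l2 : inner ℝ w (v - a) ≤ 0 :=
      le_of_tendsto' (huφ.inner (tendsto_const_nhds.sub hzφ)) fun j => h2 _ v hv
    rw [add_zero] at l1
    have e : inner ℝ w (y - v) = inner ℝ w (y - a) - inner ℝ w (v - a) := by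
      rw [← inner_sub_right]; congr 1; abel
    rw [e]
    nlinarith [mul_nonneg hρ.le (neg_nonneg.2 l2)]
  have hVlim : Tendsto (V a w) atTop (nhds 0) := by
    have hφ' : Tendsto (fun j => φ j + 1) atTop atTop :=
      (tendsto_add_atTop_nat 1).comp hφ.tendsto_atTop
    rw [tendsto_iff_tendsto_subseq_of_antitone (hanti _ _ hsaddle) hφ']
    simpa [V, Function.comp_def] using
      ((huφ.sub_const w).norm.pow 2).add ((hzφ.sub_const a).norm.pow 2)
  have hroot : ∀ (v : ℕ → E) (b : E), (∀ k, ‖v k - b‖ ^ 2 ≤ V a w k) →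
      Tendsto v atTop (nhds b) := by
    intro v b hv
    have h := (squeeze_zero (fun k => sq_nonneg ‖v k - b‖) hv hVlim).sqrt
    rw [tendsto_iff_norm_sub_tendsto_zero]
    simpa using h
  have hzl : Tendsto z atTop (nhds a) := hroot z a fun k => le_add_of_nonneg_left (sq_nonneg _)
  have hul : Tendsto u atTop (nhds w) := hroot u w fun k => le_add_of_nonneg_right (sq_nonneg _)
  refine ⟨a, w, hsaddle, ?_, hzl, hul⟩
  rw [← tendsto_add_atTop_iff_nat 1]
  simpa only [hxe, zero_add] using hdu.add ((tendsto_add_atTop_iff_nat 1).2 hzl)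

end InnerProduct

/-- A real matrix as a vector of Euclidean space, where the norm is the Frobenius norm. -/
noncomputable def matrixToEuclidean (q n : ℕ) :
    Matrix (Fin q) (Fin n) ℝ ≃ₗ[ℝ] EuclideanSpace ℝ (Fin q × Fin n) :=
  (LinearEquiv.curry ℝ ℝ (Fin q) (Fin n)).symm ≪≫ₗ (WithLp.linearEquiv 2 ℝ _).symm

theorem frobSq_eq_norm_sq {q n : ℕ} (M : Matrix (Fin q) (Fin n) ℝ) :
    frobSq M = ‖matrixToEuclidean q n M‖ ^ 2 := by
  rw [EuclideanSpace.real_norm_sq_eq, Fintype.sum_prod_type]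
  rfl

/-- Corollary 2.1: convergence of the DLMPC ADMM scheme. Under feasibility
(Slater) and attainment assumptions, the ADMM iterates for
`min f(Φ x0) s.t. ZΦ = C, Φ ∈ L, Φ x0 ∈ P` satisfy residual convergence, objective
convergence to the optimal value `p*`, and convergence of the unscaled dual variables. -/
theorem dlmpc_admm_convergence {n q s : ℕ}
    (x0 : Fin n → ℝ) (ρ : ℝ) (hρ : 0 < ρ)
    (f : (Fin q → ℝ) → ℝ) (hf : ConvexOn ℝ Set.univ f)
    (P : Set (Fin q → ℝ)) (hPne : P.Nonempty) (hPcl : IsClosed P) (hPcv : Convex ℝ P)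
    (L : Submodule ℝ (Matrix (Fin q) (Fin n) ℝ))
    (Z : Matrix (Fin s) (Fin q) ℝ) (C : Matrix (Fin s) (Fin n) ℝ)
    -- Slater-type feasibility: a feasible point whose image lies in the relative interior of P
    (hslater : ∃ Φhat ∈ L, Z * Φhat = C ∧ Φhat.mulVec x0 ∈ intrinsicInterior ℝ P)
    -- the optimal value p* is finite and attained
    (pstar : ℝ)
    (hopt : IsLeast {v : ℝ | ∃ Φ : Matrix (Fin q) (Fin n) ℝ,
      Z * Φ = C ∧ Φ ∈ L ∧ Φ.mulVec x0 ∈ P ∧ v = f (Φ.mulVec x0)} pstar)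
    -- ADMM iterates
    (Φ Ψ Λ : ℕ → Matrix (Fin q) (Fin n) ℝ)
    (hΦmem : ∀ k, Φ (k + 1) ∈ L ∧ (Φ (k + 1)).mulVec x0 ∈ P)
    (hΦmin : ∀ k, ∀ Φ' ∈ L, Φ'.mulVec x0 ∈ P →
      f ((Φ (k + 1)).mulVec x0) + ρ / 2 * frobSq (Φ (k + 1) - Ψ k + Λ k) ≤
        f (Φ'.mulVec x0) + ρ / 2 * frobSq (Φ' - Ψ k + Λ k))
    (hΨmem : ∀ k, Ψ (k + 1) ∈ L ∧ Z * Ψ (k + 1) = C)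
    (hΨmin : ∀ k, ∀ Ψ' ∈ L, Z * Ψ' = C →
      frobSq (Φ (k + 1) - Ψ (k + 1) + Λ k) ≤ frobSq (Φ (k + 1) - Ψ' + Λ k))
    (hΛupd : ∀ k, Λ (k + 1) = Λ k + Φ (k + 1) - Ψ (k + 1)) :
    Tendsto (fun k => Φ k - Ψ k) atTop (nhds 0) ∧
    Tendsto (fun k => f ((Φ k).mulVec x0)) atTop (nhds pstar) ∧
    ∃ Λbar : Matrix (Fin q) (Fin n) ℝ, Tendsto (fun k => ρ • Λ k) atTop (nhds Λbar) := by
  let e := (matrixToEuclidean q n).toContinuousLinearEquiv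
  have hnorm : ∀ M, frobSq M = ‖e M‖ ^ 2 := frobSq_eq_norm_sq
  let T : Matrix (Fin q) (Fin n) ℝ →ₗ[ℝ] Fin q → ℝ := (mulVecBilin ℝ ℝ).flip x0
  have hT : ∀ N, T N = N *ᵥ x0 := fun N => rfl
  have hTe : Continuous fun v => T (e.symm v) :=
    (LinearMap.continuous_of_finiteDimensional T).comp e.symm.continuous
  let A : Set (EuclideanSpace ℝ (Fin q × Fin n)) := {v | e.symm v ∈ L ∧ T (e.symm v) ∈ P}
  let B : Set (EuclideanSpace ℝ (Fin q × Fin n)) := {v | e.symm v ∈ L ∧ Z * e.symm v = C}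
  let g : EuclideanSpace ℝ (Fin q × Fin n) → ℝ := fun v => f (T (e.symm v))
  have hAcl : IsClosed A :=
    (L.closed_of_finiteDimensional.preimage e.symm.continuous).inter (hPcl.preimage hTe)
  have hBcl : IsClosed B :=
    (L.closed_of_finiteDimensional.preimage e.symm.continuous).inter
      (isClosed_eq (continuous_const.matrix_mul e.symm.continuous) continuous_const)
  have hgcv : ConvexOn ℝ Set.univ g := hf.comp_linearMap (T.comp e.symm.toLinearEquiv.toLinearMap)
  have hgct : Continuous g :=
    continuousOn_univ.1 (hgcv.continuousOn isOpen_univ)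
  have hAcv : Convex ℝ A :=
    (L.convex.linear_preimage e.symm.toLinearEquiv.toLinearMap).inter
      (hPcv.linear_preimage (T.comp e.symm.toLinearEquiv.toLinearMap))
  have hBcv : Convex ℝ B := by
    rintro x ⟨hxL, hxZ⟩ y ⟨hyL, hyZ⟩ α β hα hβ hαβ
    refine ⟨?_, ?_⟩
    · rw [map_add, map_smul, map_smul]
      exact L.add_mem (L.smul_mem _ hxL) (L.smul_mem _ hyL)
    · rw [map_add, map_smul, map_smul, Matrix.mul_add, Matrix.mul_smul, Matrix.mul_smul, hxZ, hyZ,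
        ← add_smul, hαβ, one_smul]
  obtain ⟨⟨M, hMZ, hML, hMP, hMval⟩, hlb⟩ := hopt
  have hlb' : ∀ x ∈ A, x ∈ B → pstar ≤ g x := fun x hxA hxB =>
    hlb ⟨e.symm x, hxB.2, hxA.1, hxA.2, rfl⟩
  have hMA : e M ∈ A := by simpa [A, hT] using ⟨hML, hMP⟩
  have hMB : e M ∈ B := by simpa [B] using ⟨hML, hMZ⟩
  have hMg : g (e M) = pstar := by simpa [g, hT] using hMval.symm
  obtain ⟨w₀, hw₀⟩ := exists_multiplier_of_relative_slater hAcv hBcv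
    (hgcv.subset (Set.subset_univ A) hAcv) hMA hMB (by rw [hMg]; exact hlb')
    (by
      obtain ⟨N, hNL, hNZ, hNP⟩ := hslater
      refine ⟨e N, fun x hx z hz => ?_⟩
      obtain ⟨ε, hε, hmem⟩ := exists_mem_lineMap_of_mem_intrinsicInterior hNP hx.2
      refine ⟨ε, hε, ⟨?_, ?_⟩, ?_, ?_⟩
      · simpa using L.add_mem hNL (L.smul_mem ε (L.sub_mem hNL hx.1))
      · rw [← hT] at hmem
        simpa using hmem
      · simpa using L.add_mem hNL (L.smul_mem ε (L.sub_mem hNL hz.1))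
      · simp [Matrix.mul_add, Matrix.mul_sub, hNZ, hz.2])
  have hΛ : ∀ k, e (Λ (k + 1)) = e (Λ k) + e (Φ (k + 1)) - e (Ψ (k + 1)) := fun k => by
    rw [hΛupd, map_sub, map_add]
  have hxA : ∀ k, e (Φ (k + 1)) ∈ A := fun k => by simpa [A, hT] using hΦmem k
  have hzB : ∀ k, e (Ψ (k + 1)) ∈ B := fun k => by simpa [B] using hΨmem k
  obtain ⟨a, w, ⟨haA, haB, hsad⟩, hx, hz, hu⟩ := admm_tendsto hAcl hBcl hgct hρ
    (x := fun k => e (Φ (k + 1))) (z := fun k => e (Ψ (k + 1))) (u := fun k => e (Λ (k + 1)))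
    hxA hzB (fun k => hΛ (k + 1))
    (by
      intro k y hy
      have h := (hgcv.subset (Set.subset_univ A) hAcv).variational_of_prox_le (ρ := ρ)
        (c := e (Ψ (k + 1)) - e (Λ (k + 1))) (hxA (k + 1))
        (by
          intro y hy
          have h := hΦmin (k + 1) (e.symm y) hy.1 hy.2
          simp only [hnorm, map_add, map_sub, e.apply_symm_apply] at h
          simp only [← sub_add, g, e.symm_apply_apply]
          exact h) y hy
      convert h using 4
      rw [hΛ (k + 1)]
      abel)
    (by
      intro k y hy
      have h := (convexOn_const (0 : ℝ) hBcv).variational_of_prox_le (ρ := 2)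
        (c := e (Φ (k + 1)) + e (Λ k)) (hzB k)
        (by
          intro y hy
          have h := hΨmin k (e.symm y) hy.1 hy.2
          simp only [hnorm, map_add, map_sub, e.apply_symm_apply] at h
          rw [norm_sub_rev, norm_sub_rev y]
          simpa only [add_sub_right_comm, zero_add, div_self (two_ne_zero' ℝ), one_mul] using h)
        y hy
      have he : e (Ψ (k + 1)) - (e (Φ (k + 1)) + e (Λ k)) = -e (Λ (k + 1)) := by
        rw [hΛ k]; abel
      rw [he, inner_neg_left] at h
      linarith)
    ⟨e M, ρ⁻¹ • w₀, hMA, hMB, fun x hx z hz => by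
      rw [real_inner_smul_left, mul_inv_cancel_left₀ hρ.ne']
      exact hw₀ x hx z hz⟩
  have hga : g a = pstar :=
    le_antisymm (by simpa [hMg] using hsad _ hMA _ hMB) (hlb' a haA haB)
  have hback : ∀ (S : ℕ → Matrix (Fin q) (Fin n) ℝ) b,
      Tendsto (fun k => e (S (k + 1))) atTop (nhds b) → Tendsto S atTop (nhds (e.symm b)) := by
    intro S b h
    rw [← tendsto_add_atTop_iff_nat 1]
    simpa [Function.comp_def] using (e.symm.continuous.tendsto b).comp h
  refine ⟨?_, ?_, ρ • e.symm w, (hback Λ w hu).const_smul ρ⟩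
  · simpa using (hback Φ a hx).sub (hback Ψ a hz)
  · rw [← tendsto_add_atTop_iff_nat 1, ← hga]
    simpa [g, Function.comp_def, hT] using (hgct.tendsto a).comp hx
end
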